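/- arXiv:2304.00161 — 5 statements merged into one kernel-verified Lean document; each statement's English description precedes it below -/
import Mathlib

section
/- Let N ≥ 2 be an integer and let μ be the Haar probability measure on the unitary group U(N). Then for all indices i₁,i₂,j₁,j₂,m₁,m₂,n₁,n₂ ∈ {1,…,N}, the integral ∫_{U(N)} U_{i₁,j₁} U_{i₂,j₂} conj(U_{m₁,n₁}) conj(U_{m₂,n₂}) dμ(U) equals (1/(N²−1))·(δ_{i₁,m₁}δ_{i₂,m₂}δ_{j₁,n₁}δ_{j₂,n₂} + δ_{i₁,m₂}δ_{i₂,m₁}δ_{j₁,n₂}δ_{j₂,n₁}) − (1/(N(N²−1)))·(δ_{i₁,m₁}δ_{i₂,m₂}δ_{j₁,n₂}δ_{j₂,n₁} + δ_{i₁,m₂}δ_{i₂,m₁}δ_{j₁,n₁}δ_{j₂,n₂}). -/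
open Matrix MeasureTheory

noncomputable instance (n : Type*) [Fintype n] [DecidableEq n] :
    MeasurableSpace (Matrix.unitaryGroup n ℂ) := borel _

instance (n : Type*) [Fintype n] [DecidableEq n] :
    BorelSpace (Matrix.unitaryGroup n ℂ) := ⟨rfl⟩

lemma Equiv.Perm.exists_apply_eq_apply_eq {n : Type*} [DecidableEq n]
    {p q p' q' : n} (h : p ≠ q) (h' : p' ≠ q') :
    ∃ σ : Equiv.Perm n, σ p = p' ∧ σ q = q' := by
  refine ⟨(Equiv.swap p p').trans (Equiv.swap (Equiv.swap p p' q) q'), ?_, ?_⟩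
  · have : p' ≠ Equiv.swap p p' q := fun e =>
      h ((Equiv.swap p p').injective (by rw [Equiv.swap_apply_left, ← e]))
    simp [Equiv.swap_apply_of_ne_of_ne this h']
  · simp

/-- A four-index tensor is invariant under `V ⊗ V ⊗ conj V ⊗ conj V` for all unitary `V`. -/
def UnitaryInvariant {n : Type*} [Fintype n] [DecidableEq n] (T : n → n → n → n → ℂ) : Prop :=
  ∀ V ∈ Matrix.unitaryGroup n ℂ, ∀ i₁ i₂ m₁ m₂, T i₁ i₂ m₁ m₂ =
    ∑ k₁, ∑ k₂, ∑ l₁, ∑ l₂,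
      V i₁ k₁ * V i₂ k₂ * star (V m₁ l₁) * star (V m₂ l₂) * T k₁ k₂ l₁ l₂

namespace UnitaryInvariant

variable {n : Type*} [Fintype n] [DecidableEq n] {T : n → n → n → n → ℂ}

lemma eq_phase_mul (hT : UnitaryInvariant T) (z : n → ℂ) (hz : ∀ k, z k * star (z k) = 1)
    (i₁ i₂ m₁ m₂ : n) :
    T i₁ i₂ m₁ m₂ = z i₁ * z i₂ * star (z m₁) * star (z m₂) * T i₁ i₂ m₁ m₂ := by
  have hV : Matrix.diagonal z ∈ Matrix.unitaryGroup n ℂ := by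
    rw [Matrix.mem_unitaryGroup_iff, Matrix.star_eq_conjTranspose,
      Matrix.diagonal_conjTranspose, Matrix.diagonal_mul_diagonal]
    simp only [Pi.star_apply, hz, Matrix.diagonal_one]
  conv_lhs => rw [hT _ hV]
  simp [Matrix.diagonal_apply, apply_ite, ite_mul]

lemma perm_apply (hT : UnitaryInvariant T) (σ : Equiv.Perm n) (i₁ i₂ m₁ m₂ : n) :
    T i₁ i₂ m₁ m₂ = T (σ i₁) (σ i₂) (σ m₁) (σ m₂) := by
  have hV : (Matrix.of fun i j => if σ i = j then (1 : ℂ) else 0) ∈ Matrix.unitaryGroup n ℂ := by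
    rw [Matrix.mem_unitaryGroup_iff]
    ext i j
    simp [Matrix.mul_apply, Matrix.star_apply, Matrix.one_apply, apply_ite, eq_comm]
  conv_lhs => rw [hT _ hV]
  simp [apply_ite, ite_mul]

lemma eq_zero (hT : UnitaryInvariant T) {i₁ i₂ m₁ m₂ : n}
    (h : ¬(i₁ = m₁ ∧ i₂ = m₂)) (h' : ¬(i₁ = m₂ ∧ i₂ = m₁)) : T i₁ i₂ m₁ m₂ = 0 := by
  have key (r : n) := hT.eq_phase_mul (fun k => if k = r then Complex.I else 1)
    (fun k => by split_ifs <;> simp) i₁ i₂ m₁ m₂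
  have hI {w : ℂ} (hw : w ≠ 1) (e : T i₁ i₂ m₁ m₂ = w * T i₁ i₂ m₁ m₂) : T i₁ i₂ m₁ m₂ = 0 := by
    have : (1 - w) * T i₁ i₂ m₁ m₂ = 0 := by linear_combination e
    exact (mul_eq_zero.1 this).resolve_left (sub_ne_zero.2 hw.symm)
  obtain ⟨r, hr⟩ : ∃ r, (if i₁ = r then 1 else 0) + (if i₂ = r then 1 else 0) ≠
      (if m₁ = r then 1 else 0) + (if m₂ = r then 1 else 0) := by
    by_contra! hc
    have h₁ := hc i₁
    have h₂ := hc i₂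
    have h₃ := hc m₁
    have h₄ := hc m₂
    grind
  refine hI ?_ (key r)
  have hI₁ : Complex.I ≠ 1 := by simp [Complex.ext_iff]
  have hI₂ : -Complex.I ≠ 1 := by simp [Complex.ext_iff]
  have hI₃ : (-1 : ℂ) ≠ 1 := by norm_num
  split_ifs at hr ⊢ <;> first | exact absurd rfl hr | simp [hI₁, hI₂, hI₃]

lemma diag_eq_add (hT : UnitaryInvariant T) {p q : n} (h : p ≠ q) :
    T p p p p = T p q p q + T p q q p := by
  let v : n → ℂ := Pi.single p 1 + Pi.single q 2
  let V : Matrix n n ℂ := 1 - (2 / 5 : ℂ) • Matrix.vecMulVec v v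
  have hs : star V = V := by
    ext i j
    have hv (k : n) : star (v k) = v k := by
      simp only [v, Pi.add_apply, Pi.single_apply]
      split_ifs <;> simp
    simp only [V, Matrix.star_apply, Matrix.sub_apply, Matrix.smul_apply,
      Matrix.vecMulVec_apply, star_sub, star_mul', hv, smul_eq_mul, Matrix.one_apply]
    by_cases hij : i = j <;> simp [hij, eq_comm, mul_comm]
  have hvv : v ⬝ᵥ v = 5 := by
    simp [v, h, h.symm]
    norm_num
  have hV : V ∈ Matrix.unitaryGroup n ℂ := by
    rw [Matrix.mem_unitaryGroup_iff, hs]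
    have : Matrix.vecMulVec v v * Matrix.vecMulVec v v = (5 : ℂ) • Matrix.vecMulVec v v := by
      rw [Matrix.vecMulVec_mul_vecMulVec, hvv, Matrix.vecMulVec_smul]
    simp only [V, sub_mul, mul_sub, one_mul, mul_one, smul_mul_smul_comm, this, smul_smul]
    module
  have hrow (k : n) : V p k = (if k = p then 3 / 5 else 0) + (if k = q then -(4 / 5) else 0) := by
    simp only [V, v, Matrix.sub_apply, Matrix.one_apply, Matrix.smul_apply,
      Matrix.vecMulVec_apply, Pi.add_apply, Pi.single_apply, smul_eq_mul]
    by_cases hp : k = p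
    · subst hp
      simp [h]
      norm_num
    · by_cases hq : k = q
      · subst hq
        simp [h, h.symm]
        norm_num
      · simp [hp, hq, Ne.symm hp]
  have hrow' (k : n) : star (V p k) = V p k := by
    rw [hrow]
    split_ifs <;> simp
  have h₁ := hT V hV p p p p
  simp only [hrow'] at h₁
  simp only [hrow, mul_add, add_mul, Finset.sum_add_distrib, mul_ite, ite_mul, zero_mul,
    mul_zero, Finset.sum_ite_eq', Finset.mem_univ, if_true] at h₁
  have hz {i₁ i₂ m₁ m₂ : n} := @eq_zero _ _ _ _ hT i₁ i₂ m₁ m₂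
  have hq := hT.perm_apply (Equiv.swap p q) p p p p
  have hB := hT.perm_apply (Equiv.swap p q) p q p q
  have hC := hT.perm_apply (Equiv.swap p q) p q q p
  simp only [Equiv.swap_apply_left, Equiv.swap_apply_right] at hq hB hC
  simp only [hz, h, h.symm, and_self, and_true, and_false, not_false_eq_true,
    ← hq, ← hB, ← hC] at h₁
  linear_combination (625 / 288 : ℂ) * h₁

/-- The invariants of `V ⊗ V ⊗ conj V ⊗ conj V` are spanned by the two pairings. -/
lemma exists_eq_pairings [Nontrivial n] (hT : UnitaryInvariant T) :
    ∃ a b : ℂ, ∀ i₁ i₂ m₁ m₂, T i₁ i₂ m₁ m₂ =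
      a * ((if i₁ = m₁ then 1 else 0) * (if i₂ = m₂ then 1 else 0)) +
      b * ((if i₁ = m₂ then 1 else 0) * (if i₂ = m₁ then 1 else 0)) := by
  obtain ⟨p, q, hpq⟩ := exists_pair_ne n
  have hne {i j : n} (hij : i ≠ j) : T i j i j = T p q p q ∧ T i j j i = T p q q p := by
    obtain ⟨σ, rfl, rfl⟩ := Equiv.Perm.exists_apply_eq_apply_eq hpq hij
    exact ⟨(hT.perm_apply σ _ _ _ _).symm, (hT.perm_apply σ _ _ _ _).symm⟩
  refine ⟨T p q p q, T p q q p, fun i₁ i₂ m₁ m₂ => ?_⟩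
  by_cases h : i₁ = m₁ ∧ i₂ = m₂
  · obtain ⟨rfl, rfl⟩ := h
    by_cases hij : i₁ = i₂
    · subst hij
      obtain ⟨j, hj⟩ := exists_ne i₁
      simp [hT.diag_eq_add hj.symm, hne hj.symm]
    · simp [hij, hne hij]
  · by_cases h' : i₁ = m₂ ∧ i₂ = m₁
    · obtain ⟨rfl, rfl⟩ := h'
      have hij : i₁ ≠ i₂ := by grind
      simp [hij, hne hij]
    · simp [hT.eq_zero h h', ← ite_and, h, h', and_comm]

end UnitaryInvariant

/-- The degree `(2, 2)` monomial in the entries of a matrix and their conjugates. -/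
def entryMonomial {n : Type*} (j₁ j₂ n₁ n₂ i₁ i₂ m₁ m₂ : n) (U : Matrix n n ℂ) : ℂ :=
  U i₁ j₁ * U i₂ j₂ * (starRingEnd ℂ) (U m₁ n₁) * (starRingEnd ℂ) (U m₂ n₂)

lemma entryMonomial_mul {n : Type*} [Fintype n] (j₁ j₂ n₁ n₂ i₁ i₂ m₁ m₂ : n) (V U : Matrix n n ℂ) :
    entryMonomial j₁ j₂ n₁ n₂ i₁ i₂ m₁ m₂ (V * U) = ∑ k₁, ∑ k₂, ∑ l₁, ∑ l₂,
      V i₁ k₁ * V i₂ k₂ * star (V m₁ l₁) * star (V m₂ l₂) *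
        entryMonomial j₁ j₂ n₁ n₂ k₁ k₂ l₁ l₂ U := by
  have h (k₁ k₂ l₁ l₂ : n) : V i₁ k₁ * V i₂ k₂ * star (V m₁ l₁) * star (V m₂ l₂) *
      entryMonomial j₁ j₂ n₁ n₂ k₁ k₂ l₁ l₂ U =
      V i₁ k₁ * U k₁ j₁ * (V i₂ k₂ * U k₂ j₂ * (star (V m₁ l₁) * star (U l₁ n₁) *
        (star (V m₂ l₂) * star (U l₂ n₂)))) := by
    simp only [entryMonomial, starRingEnd_apply]
    ring
  simp only [h, ← Finset.mul_sum, ← Finset.sum_mul]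
  simp only [entryMonomial, Matrix.mul_apply, map_sum, map_mul, starRingEnd_apply, mul_assoc]

section Haar

variable {n : Type*} [Fintype n] [DecidableEq n] (μ : Measure (Matrix.unitaryGroup n ℂ))

lemma integrable_entryMonomial [IsFiniteMeasure μ] (j₁ j₂ n₁ n₂ i₁ i₂ m₁ m₂ : n) :
    Integrable (fun U : Matrix.unitaryGroup n ℂ =>
      entryMonomial j₁ j₂ n₁ n₂ i₁ i₂ m₁ m₂ (U : Matrix n n ℂ)) μ := by
  have hc (i j : n) : Continuous fun U : Matrix.unitaryGroup n ℂ => (U : Matrix n n ℂ) i j :=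
    continuous_subtype_val.matrix_elem i j
  refine Integrable.of_bound (C := 1) (Continuous.aestronglyMeasurable ?_)
    (Filter.Eventually.of_forall fun U => ?_)
  · unfold entryMonomial
    exact (((hc _ _).mul (hc _ _)).mul (Complex.continuous_conj.comp (hc _ _))).mul
      (Complex.continuous_conj.comp (hc _ _))
  · have hb (i j : n) := entry_norm_bound_of_unitary U.2 i j
    simp only [entryMonomial, norm_mul, RCLike.norm_conj]
    exact mul_le_one₀ (mul_le_one₀ (mul_le_one₀ (hb _ _) (norm_nonneg _) (hb _ _))
      (norm_nonneg _) (hb _ _)) (norm_nonneg _) (hb _ _)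

lemma unitaryInvariant_integral [IsFiniteMeasure μ] [μ.IsMulLeftInvariant] (j₁ j₂ n₁ n₂ : n) :
    UnitaryInvariant fun i₁ i₂ m₁ m₂ => ∫ U : Matrix.unitaryGroup n ℂ,
      entryMonomial j₁ j₂ n₁ n₂ i₁ i₂ m₁ m₂ (U : Matrix n n ℂ) ∂μ := by
  intro V hV i₁ i₂ m₁ m₂
  have hi (k₁ k₂ l₁ l₂ : n) (c : ℂ) :=
    (integrable_entryMonomial μ j₁ j₂ n₁ n₂ k₁ k₂ l₁ l₂).const_mul c
  dsimp only
  rw [← integral_mul_left_eq_self _ (⟨V, hV⟩ : Matrix.unitaryGroup n ℂ)]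
  simp only [Matrix.UnitaryGroup.mul_val, entryMonomial_mul]
  rw [integral_finsetSum _ fun _ _ => integrable_finsetSum _ fun _ _ => integrable_finsetSum _
    fun _ _ => integrable_finsetSum _ fun _ _ => hi _ _ _ _ _]
  refine Finset.sum_congr rfl fun k₁ _ => ?_
  rw [integral_finsetSum _ fun _ _ => integrable_finsetSum _
    fun _ _ => integrable_finsetSum _ fun _ _ => hi _ _ _ _ _]
  refine Finset.sum_congr rfl fun k₂ _ => ?_
  rw [integral_finsetSum _ fun _ _ => integrable_finsetSum _ fun _ _ => hi _ _ _ _ _]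
  refine Finset.sum_congr rfl fun l₁ _ => ?_
  rw [integral_finsetSum _ fun _ _ => hi _ _ _ _ _]
  exact Finset.sum_congr rfl fun l₂ _ => integral_const_mul _ _

lemma sum_mul_conj_of_mem_unitaryGroup {U : Matrix n n ℂ} (hU : U ∈ Matrix.unitaryGroup n ℂ)
    (j k : n) : ∑ i, U i j * (starRingEnd ℂ) (U i k) = if j = k then 1 else 0 := by
  have h := congrFun₂ (Matrix.mem_unitaryGroup_iff'.1 hU) k j
  simpa [Matrix.mul_apply, Matrix.star_apply, Matrix.one_apply, mul_comm, eq_comm] using h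

variable [IsProbabilityMeasure μ]

lemma sum_integral_entryMonomial_direct (j₁ j₂ n₁ n₂ : n) :
    ∑ i₁, ∑ i₂, ∫ U : Matrix.unitaryGroup n ℂ,
      entryMonomial j₁ j₂ n₁ n₂ i₁ i₂ i₁ i₂ (U : Matrix n n ℂ) ∂μ =
      (if j₁ = n₁ then 1 else 0) * (if j₂ = n₂ then 1 else 0) := by
  have hi (i₁ i₂ : n) := integrable_entryMonomial μ j₁ j₂ n₁ n₂ i₁ i₂ i₁ i₂
  simp_rw [← integral_finsetSum _ fun i₂ _ => hi _ i₂]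
  rw [← integral_finsetSum _ fun i₁ _ => integrable_finsetSum _ fun i₂ _ => hi i₁ i₂]
  have h (U : Matrix.unitaryGroup n ℂ) : ∑ i₁, ∑ i₂,
      entryMonomial j₁ j₂ n₁ n₂ i₁ i₂ i₁ i₂ (U : Matrix n n ℂ) =
      (if j₁ = n₁ then 1 else 0) * (if j₂ = n₂ then 1 else 0) := by
    rw [← sum_mul_conj_of_mem_unitaryGroup U.2, ← sum_mul_conj_of_mem_unitaryGroup U.2,
      Finset.sum_mul_sum]
    exact Finset.sum_congr rfl fun _ _ => Finset.sum_congr rfl fun _ _ => by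
      rw [entryMonomial]; ring
  simp [h]

lemma sum_integral_entryMonomial_crossed (j₁ j₂ n₁ n₂ : n) :
    ∑ i₁, ∑ i₂, ∫ U : Matrix.unitaryGroup n ℂ,
      entryMonomial j₁ j₂ n₁ n₂ i₁ i₂ i₂ i₁ (U : Matrix n n ℂ) ∂μ =
      (if j₁ = n₂ then 1 else 0) * (if j₂ = n₁ then 1 else 0) := by
  rw [← sum_integral_entryMonomial_direct μ j₁ j₂ n₂ n₁]
  simp only [entryMonomial, mul_right_comm]

end Haar

/-- Second-moment Weingarten formula for the Haar probability measure on `U(N)`, `N ≥ 2`. -/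
theorem haar_second_moment (N : ℕ) (hN : 2 ≤ N)
    (μ : Measure (Matrix.unitaryGroup (Fin N) ℂ))
    [μ.IsHaarMeasure] [IsProbabilityMeasure μ]
    (i₁ i₂ j₁ j₂ m₁ m₂ n₁ n₂ : Fin N) :
    ∫ U, ((U : Matrix (Fin N) (Fin N) ℂ) i₁ j₁) * ((U : Matrix (Fin N) (Fin N) ℂ) i₂ j₂) *
        (starRingEnd ℂ) ((U : Matrix (Fin N) (Fin N) ℂ) m₁ n₁) *
        (starRingEnd ℂ) ((U : Matrix (Fin N) (Fin N) ℂ) m₂ n₂) ∂μ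
      = (1 / ((N : ℂ) ^ 2 - 1)) *
          ((if i₁ = m₁ then 1 else 0) * (if i₂ = m₂ then 1 else 0) *
              (if j₁ = n₁ then 1 else 0) * (if j₂ = n₂ then 1 else 0)
            + (if i₁ = m₂ then 1 else 0) * (if i₂ = m₁ then 1 else 0) *
              (if j₁ = n₂ then 1 else 0) * (if j₂ = n₁ then 1 else 0))
        - (1 / ((N : ℂ) * ((N : ℂ) ^ 2 - 1))) *
          ((if i₁ = m₁ then 1 else 0) * (if i₂ = m₂ then 1 else 0) *
              (if j₁ = n₂ then 1 else 0) * (if j₂ = n₁ then 1 else 0)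
            + (if i₁ = m₂ then 1 else 0) * (if i₂ = m₁ then 1 else 0) *
              (if j₁ = n₁ then 1 else 0) * (if j₂ = n₂ then 1 else 0)) := by
  have : Nontrivial (Fin N) := Fin.nontrivial_iff_two_le.2 hN
  obtain ⟨a, b, hab⟩ := (unitaryInvariant_integral μ j₁ j₂ n₁ n₂).exists_eq_pairings
  have h₁ := sum_integral_entryMonomial_direct μ j₁ j₂ n₁ n₂
  have h₂ := sum_integral_entryMonomial_crossed μ j₁ j₂ n₁ n₂
  simp only [hab] at h₁ h₂
  have hN₀ : (N : ℂ) ≠ 0 := by exact_mod_cast (by omega : N ≠ 0)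
  have hN₁ : (N : ℂ) ^ 2 - 1 ≠ 0 := by
    rw [sub_ne_zero]
    exact_mod_cast (by nlinarith : N ^ 2 ≠ 1)
  have hd : ∑ _i : Fin N, ∑ _j : Fin N, (1 : ℂ) = (N : ℂ) * N := by
    simp
  have hc : ∑ i : Fin N, ∑ j : Fin N,
      ((if i = j then 1 else 0) * (if j = i then 1 else 0) : ℂ) = N := by
    simp
  simp only [if_true, one_mul, Finset.sum_add_distrib, ← Finset.mul_sum, hd, hc] at h₁ h₂
  have ha : a = 1 / ((N : ℂ) ^ 2 - 1) * ((if j₁ = n₁ then 1 else 0) * (if j₂ = n₂ then 1 else 0)) -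
      1 / (N * ((N : ℂ) ^ 2 - 1)) *
        ((if j₁ = n₂ then 1 else 0) * (if j₂ = n₁ then 1 else 0)) := by
    rw [← h₁, ← h₂]
    field_simp
    ring
  have hb : b = 1 / ((N : ℂ) ^ 2 - 1) * ((if j₁ = n₂ then 1 else 0) * (if j₂ = n₁ then 1 else 0)) -
      1 / (N * ((N : ℂ) ^ 2 - 1)) *
        ((if j₁ = n₁ then 1 else 0) * (if j₂ = n₂ then 1 else 0)) := by
    rw [← h₁, ← h₂]
    field_simp
    ring
  refine (hab i₁ i₂ m₁ m₂).trans ?_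
  rw [ha, hb]
  ring
end

section
/- Let N ≥ 2 be an integer and let μ be the Haar probability measure on U(N). Let Swap denote the operator on ℂ^N ⊗ ℂ^N determined by Swap(|i⟩⊗|j⟩) = |j⟩⊗|i⟩, and set P₊ = (1 + Swap)/2 and P₋ = (1 − Swap)/2, where 1 is the identity on ℂ^N ⊗ ℂ^N. Then for every linear operator R on ℂ^N ⊗ ℂ^N, ∫_{U(N)} (U⊗U) R (U†⊗U†) dμ(U) = (2/(N(N+1))) · P₊ · Tr(P₊ R) + (2/(N(N−1))) · P₋ · Tr(P₋ R). -/
open Matrix MeasureTheory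
open scoped Kronecker

/-- The swap operator on `ℂ^N ⊗ ℂ^N`, determined by `Swap (|i⟩⊗|j⟩) = |j⟩⊗|i⟩`. -/
def swapOp (N : ℕ) : Matrix (Fin N × Fin N) (Fin N × Fin N) ℂ :=
  fun p q => if p.1 = q.2 ∧ p.2 = q.1 then 1 else 0

/-- The projector onto the permutation-symmetric subspace of `ℂ^N ⊗ ℂ^N`. -/
noncomputable def Pplus (N : ℕ) : Matrix (Fin N × Fin N) (Fin N × Fin N) ℂ :=
  (1 / 2 : ℂ) • ((1 : Matrix (Fin N × Fin N) (Fin N × Fin N) ℂ) + swapOp N)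

/-- The projector onto the permutation-antisymmetric subspace of `ℂ^N ⊗ ℂ^N`. -/
noncomputable def Pminus (N : ℕ) : Matrix (Fin N × Fin N) (Fin N × Fin N) ℂ :=
  (1 / 2 : ℂ) • ((1 : Matrix (Fin N × Fin N) (Fin N × Fin N) ℂ) - swapOp N)
/-- An operator commuting with every `V ⊗ V`, `V` unitary, is entrywise invariant under
simultaneous permutation of the indices. -/
lemma apply_perm_of_commute_kronecker {n : Type*} [Fintype n] [DecidableEq n]
    {A : Matrix (n × n) (n × n) ℂ}
    (hA : ∀ V ∈ Matrix.unitaryGroup n ℂ, (V ⊗ₖ V) * A = A * (V ⊗ₖ V))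
    (σ : Equiv.Perm n) (i j k l : n) :
    A (σ i, σ j) (σ k, σ l) = A (i, j) (k, l) := by
  have hV : (σ.permMatrix ℂ) ∈ Matrix.unitaryGroup n ℂ := by
    rw [Matrix.mem_unitaryGroup_iff, Matrix.star_eq_conjTranspose,
      Matrix.conjTranspose_permMatrix, ← Matrix.permMatrix_mul]
    simp
  have h := congrFun (congrFun (hA _ hV) (i, j)) (σ k, σ l)
  simp only [Matrix.mul_apply, Fintype.sum_prod_type, Matrix.kroneckerMap_apply,
    Equiv.Perm.permMatrix, PEquiv.toMatrix_apply, Equiv.toPEquiv_apply, Option.mem_some_iff] at h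
  simpa [ite_and] using h

/-- An operator commuting with every `V ⊗ V`, `V` diagonal unitary, preserves weight spaces. -/
lemma apply_eq_zero_of_commute_kronecker {n : Type*} [Fintype n] [DecidableEq n]
    {A : Matrix (n × n) (n × n) ℂ}
    (hA : ∀ V ∈ Matrix.unitaryGroup n ℂ, (V ⊗ₖ V) * A = A * (V ⊗ₖ V))
    {i j k l : n} (h₁ : ¬(i = k ∧ j = l)) (h₂ : ¬(i = l ∧ j = k)) :
    A (i, j) (k, l) = 0 := by
  have key (m : n) : ((if i = m then Complex.I else 1) * (if j = m then Complex.I else 1)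
      - (if k = m then Complex.I else 1) * (if l = m then Complex.I else 1))
        * A (i, j) (k, l) = 0 := by
    set d : n → ℂ := fun x => if x = m then Complex.I else 1 with hd
    have hV : Matrix.diagonal d ∈ Matrix.unitaryGroup n ℂ := by
      rw [Matrix.mem_unitaryGroup_iff, Matrix.star_eq_conjTranspose,
        Matrix.diagonal_conjTranspose, Matrix.diagonal_mul_diagonal, ← Matrix.diagonal_one]
      congr 1
      ext x
      by_cases hx : x = m <;> simp [hd, hx]
    have h := congrFun (congrFun (hA _ hV) (i, j)) (k, l)
    rw [Matrix.diagonal_kronecker_diagonal, Matrix.diagonal_mul, Matrix.mul_diagonal] at h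
    linear_combination h
  have e1 : Complex.I ≠ 1 := fun h => by simpa using congrArg Complex.re h
  have e2 : Complex.I * Complex.I ≠ 1 := by rw [Complex.I_mul_I]; norm_num
  have e3 : Complex.I * Complex.I ≠ Complex.I := by
    intro h; simpa using congrArg Complex.im h
  have ki := key i
  have kj := key j
  by_contra h0
  simp only [mul_eq_zero, h0, or_false, sub_eq_zero, if_true] at ki kj
  grind

/-- A unitary matrix with no vanishing entry. -/
lemma exists_unitary_apply_ne_zero (N : ℕ) (hN : 2 ≤ N) :
    ∃ V ∈ Matrix.unitaryGroup (Fin N) ℂ, ∀ i j, V i j ≠ 0 := by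
  have hN0 : (N : ℂ) ≠ 0 := by norm_cast; omega
  refine ⟨1 - Matrix.of fun _ _ => (1 - Complex.I) / N, ?_, ?_⟩
  · rw [Matrix.mem_unitaryGroup_iff, Matrix.star_eq_conjTranspose]
    have h : (1 - Matrix.of fun _ _ => (1 - Complex.I) / N : Matrix (Fin N) (Fin N) ℂ)ᴴ
        = 1 - Matrix.of fun _ _ => (1 + Complex.I) / N := by
      ext i j
      simp [Matrix.conjTranspose_apply, Matrix.one_apply, eq_comm, apply_ite]
    rw [h, sub_mul, mul_sub, mul_sub, one_mul, one_mul, mul_one]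
    ext i j
    simp only [Matrix.sub_apply, Matrix.mul_apply, Matrix.of_apply, Finset.sum_const,
      Finset.card_univ, Fintype.card_fin, nsmul_eq_mul]
    field_simp
    ring_nf
    simp [Complex.I_sq]
  · intro i j h
    simp only [Matrix.sub_apply, Matrix.of_apply, Matrix.one_apply, sub_eq_zero] at h
    rw [eq_div_iff hN0] at h
    have := congrArg Complex.im h
    split_ifs at this <;> simp at this

/-- The commutant of `{V ⊗ V | V unitary}` is spanned by the identity and the swap. -/
lemma eq_smul_one_add_smul_swapOp {N : ℕ} (hN : 2 ≤ N)
    {A : Matrix (Fin N × Fin N) (Fin N × Fin N) ℂ}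
    (hA : ∀ V ∈ Matrix.unitaryGroup (Fin N) ℂ, (V ⊗ₖ V) * A = A * (V ⊗ₖ V)) :
    ∃ b c : ℂ, A = b • 1 + c • swapOp N := by
  obtain ⟨V, hV, hV0⟩ := exists_unitary_apply_ne_zero N hN
  let x : Fin N := ⟨0, by omega⟩
  let y : Fin N := ⟨1, by omega⟩
  have hxy : x ≠ y := by simp [x, y]
  have trans (i j : Fin N) (hij : i ≠ j) : ∃ σ : Equiv.Perm (Fin N), σ x = i ∧ σ y = j := by
    refine ⟨(Equiv.swap x i).trans (Equiv.swap (Equiv.swap x i y) j), ?_, ?_⟩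
    · simp only [Equiv.trans_apply, Equiv.swap_apply_left]
      refine Equiv.swap_apply_of_ne_of_ne (fun h => hxy ?_) hij
      apply (Equiv.swap x i).injective
      rw [← h, Equiv.swap_apply_left]
    · simp
  have hb (i j : Fin N) (hij : i ≠ j) : A (i, j) (i, j) = A (x, y) (x, y) := by
    obtain ⟨σ, rfl, rfl⟩ := trans i j hij
    exact apply_perm_of_commute_kronecker hA σ _ _ _ _
  have hc (i j : Fin N) (hij : i ≠ j) : A (i, j) (j, i) = A (x, y) (y, x) := by
    obtain ⟨σ, rfl, rfl⟩ := trans i j hij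
    exact apply_perm_of_commute_kronecker hA σ _ _ _ _
  have ha (i : Fin N) : A (i, i) (i, i) = A (x, y) (x, y) + A (x, y) (y, x) := by
    have h := congrFun (congrFun (hA V hV) (i, i)) (x, y)
    rw [Matrix.mul_apply, Matrix.mul_apply,
      Finset.sum_eq_add_of_mem (x, y) (y, x) (Finset.mem_univ _) (Finset.mem_univ _)
        (by simp [hxy]), Finset.sum_eq_single_of_mem (i, i) (Finset.mem_univ _)] at h
    · simp only [Matrix.kroneckerMap_apply] at h
      rw [hc y x hxy.symm] at h
      apply mul_left_cancel₀ (mul_ne_zero (hV0 i x) (hV0 i y))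
      linear_combination -h
    · rintro ⟨k, l⟩ - h₁
      rw [apply_eq_zero_of_commute_kronecker hA, zero_mul] <;> grind
    · rintro ⟨k, l⟩ - ⟨h₁, h₂⟩
      rw [apply_eq_zero_of_commute_kronecker hA, mul_zero] <;> grind
  refine ⟨A (x, y) (x, y), A (x, y) (y, x), ?_⟩
  ext ⟨i, j⟩ ⟨k, l⟩
  simp only [Matrix.add_apply, Matrix.smul_apply, Matrix.one_apply, swapOp, smul_eq_mul,
    Prod.mk.injEq]
  by_cases h₁ : i = k ∧ j = l
  · obtain ⟨rfl, rfl⟩ := h₁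
    by_cases hij : i = j
    · subst hij
      simp [ha]
    · simp [hij, hb i j hij]
  · by_cases h₂ : i = l ∧ j = k
    · obtain ⟨rfl, rfl⟩ := h₂
      have hij : i ≠ j := fun h => h₁ ⟨h, h.symm⟩
      simp [hij, hc i j hij]
    · simp [h₁, h₂, apply_eq_zero_of_commute_kronecker hA h₁ h₂]

lemma swapOp_mul_apply (N : ℕ) (A : Matrix (Fin N × Fin N) (Fin N × Fin N) ℂ)
    (p q : Fin N × Fin N) : (swapOp N * A) p q = A p.swap q := by
  rw [Matrix.mul_apply, Finset.sum_eq_single_of_mem p.swap (Finset.mem_univ _)]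
  · simp [swapOp]
  · rintro ⟨k, l⟩ - h
    have : ¬(p.1 = l ∧ p.2 = k) := by
      rintro ⟨rfl, rfl⟩
      exact h rfl
    simp [swapOp, this]

lemma swapOp_mul_swapOp (N : ℕ) : swapOp N * swapOp N = 1 := by
  ext p q
  rw [swapOp_mul_apply]
  simp [swapOp, Matrix.one_apply, Prod.ext_iff, and_comm]

lemma trace_swapOp (N : ℕ) : (swapOp N).trace = N := by
  simp [Matrix.trace, swapOp, Fintype.sum_prod_type, ite_and]

lemma kronecker_self_mul_swapOp {N : ℕ} (V : Matrix (Fin N) (Fin N) ℂ) :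
    (V ⊗ₖ V) * swapOp N = swapOp N * (V ⊗ₖ V) := by
  ext ⟨i, j⟩ ⟨k, l⟩
  rw [swapOp_mul_apply, Matrix.mul_apply,
    Finset.sum_eq_single_of_mem (l, k) (Finset.mem_univ _)]
  · simp [swapOp, mul_comm]
  · rintro ⟨a, b⟩ - h
    have : ¬(a = l ∧ b = k) := by simpa using h
    simp [swapOp, this]

lemma kronecker_conjTranspose_mul_self {n : Type*} [Fintype n] [DecidableEq n]
    {V : Matrix n n ℂ} (hV : V ∈ Matrix.unitaryGroup n ℂ) : (Vᴴ ⊗ₖ Vᴴ) * (V ⊗ₖ V) = 1 := by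
  rw [← Matrix.mul_kronecker_mul, ← Matrix.star_eq_conjTranspose,
    Matrix.mem_unitaryGroup_iff'.1 hV, Matrix.one_kronecker_one]

lemma continuous_kronecker_conj_apply {n : Type*} [Fintype n] [DecidableEq n]
    (R : Matrix (n × n) (n × n) ℂ) (p q : n × n) :
    Continuous fun U : Matrix.unitaryGroup n ℂ =>
      (((U : Matrix n n ℂ) ⊗ₖ (U : Matrix n n ℂ)) * R *
        ((U : Matrix n n ℂ)ᴴ ⊗ₖ (U : Matrix n n ℂ)ᴴ)) p q := by
  have h (i j : n) : Continuous fun U : Matrix.unitaryGroup n ℂ => (U : Matrix n n ℂ) i j :=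
    continuous_subtype_val.matrix_elem i j
  simp only [Matrix.mul_apply, Matrix.kroneckerMap_apply, Matrix.conjTranspose_apply]
  exact continuous_finsetSum _ fun b _ =>
    (continuous_finsetSum _ fun a _ => ((h _ _).mul (h _ _)).mul continuous_const).mul
      ((h _ _).star.mul (h _ _).star)

lemma integrable_kronecker_conj_apply {n : Type*} [Fintype n] [DecidableEq n]
    (μ : Measure (Matrix.unitaryGroup n ℂ)) [IsFiniteMeasure μ]
    (R : Matrix (n × n) (n × n) ℂ) (p q : n × n) :
    Integrable (fun U : Matrix.unitaryGroup n ℂ =>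
      (((U : Matrix n n ℂ) ⊗ₖ (U : Matrix n n ℂ)) * R *
        ((U : Matrix n n ℂ)ᴴ ⊗ₖ (U : Matrix n n ℂ)ᴴ)) p q) μ := by
  refine Integrable.of_bound
    (continuous_kronecker_conj_apply R p q).aestronglyMeasurable
    (∑ b : n × n, ∑ a : n × n, ‖R a b‖) (ae_of_all _ fun U => ?_)
  have h (i j : n) : ‖(U : Matrix n n ℂ) i j‖ ≤ 1 := entry_norm_bound_of_unitary U.2 i j
  have h2 (i j k l : n) : ‖(U : Matrix n n ℂ) i j‖ * ‖(U : Matrix n n ℂ) k l‖ ≤ 1 :=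
    mul_le_one₀ (h i j) (norm_nonneg _) (h k l)
  simp only [Matrix.mul_apply, Matrix.kroneckerMap_apply, Matrix.conjTranspose_apply,
    Finset.sum_mul]
  refine (norm_sum_le _ _).trans (Finset.sum_le_sum fun b _ => ?_)
  refine (norm_sum_le _ _).trans (Finset.sum_le_sum fun a _ => ?_)
  simp only [norm_mul, norm_star]
  calc _ ≤ 1 * ‖R a b‖ * 1 := by gcongr <;> apply h2
    _ = ‖R a b‖ := by ring

/-- A linear functional commutes with entrywise integration. -/
lemma integral_linearMap_matrix {m n X : Type*} [Fintype m] [Fintype n] [DecidableEq m]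
    [DecidableEq n] [MeasurableSpace X] (μ : Measure X) (F : X → Matrix m n ℂ)
    (hF : ∀ i j, Integrable (fun x => F x i j) μ) (L : Matrix m n ℂ →ₗ[ℂ] ℂ) :
    ∫ x, L (F x) ∂μ = L (Matrix.of fun i j => ∫ x, F x i j ∂μ) := by
  have hL (A : Matrix m n ℂ) : L A = ∑ i, ∑ j, A i j * L (Matrix.single i j 1) := by
    conv_lhs => rw [Matrix.matrix_eq_sum_single A]
    simp only [map_sum]
    refine Finset.sum_congr rfl fun i _ => Finset.sum_congr rfl fun j _ => ?_
    rw [← smul_eq_mul, ← map_smul, Matrix.smul_single, smul_eq_mul, mul_one]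
  rw [hL]
  simp_rw [fun x => hL (F x)]
  rw [integral_finsetSum _ fun i _ => integrable_finsetSum _ fun j _ => (hF i j).mul_const _]
  refine Finset.sum_congr rfl fun i _ => ?_
  rw [integral_finsetSum _ fun j _ => (hF i j).mul_const _]
  refine Finset.sum_congr rfl fun j _ => ?_
  rw [integral_mul_const, Matrix.of_apply]

/-- The doubled fully depolarizing channel:
`∫ (U⊗U) R (U†⊗U†) dμ(U) = (2/(N(N+1))) Tr(P₊R) P₊ + (2/(N(N−1))) Tr(P₋R) P₋`. -/
theorem doubled_fully_depolarizing_channel (N : ℕ) (hN : 2 ≤ N)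
    (μ : Measure (Matrix.unitaryGroup (Fin N) ℂ))
    [μ.IsHaarMeasure] [IsProbabilityMeasure μ]
    (R : Matrix (Fin N × Fin N) (Fin N × Fin N) ℂ) (p q : Fin N × Fin N) :
    ∫ U, (((U : Matrix (Fin N) (Fin N) ℂ) ⊗ₖ (U : Matrix (Fin N) (Fin N) ℂ)) * R *
          (((U : Matrix (Fin N) (Fin N) ℂ))ᴴ ⊗ₖ ((U : Matrix (Fin N) (Fin N) ℂ))ᴴ)) p q ∂μ
      = ((2 / ((N : ℂ) * ((N : ℂ) + 1)) * (Pplus N * R).trace) • Pplus N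
          + (2 / ((N : ℂ) * ((N : ℂ) - 1)) * (Pminus N * R).trace) • Pminus N) p q := by
  set F : Matrix.unitaryGroup (Fin N) ℂ → Matrix (Fin N × Fin N) (Fin N × Fin N) ℂ :=
    fun U => ((U : Matrix (Fin N) (Fin N) ℂ) ⊗ₖ (U : Matrix (Fin N) (Fin N) ℂ)) * R *
      ((U : Matrix (Fin N) (Fin N) ℂ)ᴴ ⊗ₖ (U : Matrix (Fin N) (Fin N) ℂ)ᴴ) with hF
  have hint : ∀ i j, Integrable (fun U => F U i j) μ := integrable_kronecker_conj_apply μ R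
  set M : Matrix (Fin N × Fin N) (Fin N × Fin N) ℂ :=
    Matrix.of fun i j => ∫ U, F U i j ∂μ with hM
  have hcomm : ∀ V ∈ Matrix.unitaryGroup (Fin N) ℂ, (V ⊗ₖ V) * M = M * (V ⊗ₖ V) := by
    intro V hV
    have hconj : (V ⊗ₖ V) * M * (Vᴴ ⊗ₖ Vᴴ) = M := by
      ext i j
      have h := integral_linearMap_matrix μ F hint
        (Matrix.entryLinearMap ℂ ℂ i j ∘ₗ LinearMap.mulRight ℂ (Vᴴ ⊗ₖ Vᴴ) ∘ₗ
          LinearMap.mulLeft ℂ (V ⊗ₖ V))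
      simp only [LinearMap.comp_apply, LinearMap.mulLeft_apply, LinearMap.mulRight_apply,
        Matrix.entryLinearMap_apply] at h
      rw [← hM] at h
      rw [← h, hM, Matrix.of_apply,
        ← integral_mul_left_eq_self (fun U => F U i j) (⟨V, hV⟩ : Matrix.unitaryGroup (Fin N) ℂ)]
      congr 1
      ext U
      simp only [hF, Submonoid.coe_mul, Matrix.conjTranspose_mul, Matrix.mul_kronecker_mul,
        Matrix.mul_assoc]
    conv_rhs => rw [← hconj]
    rw [Matrix.mul_assoc, kronecker_conjTranspose_mul_self hV, Matrix.mul_one]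
  obtain ⟨b, c, hbc⟩ := eq_smul_one_add_smul_swapOp hN hcomm
  have htr : M.trace = R.trace := by
    have h := integral_linearMap_matrix μ F hint (Matrix.traceLinearMap _ ℂ ℂ)
    simp only [Matrix.traceLinearMap_apply] at h
    rw [← hM] at h
    have hU (U : Matrix.unitaryGroup (Fin N) ℂ) : (F U).trace = R.trace := by
      rw [hF, Matrix.trace_mul_comm, ← Matrix.mul_assoc,
        kronecker_conjTranspose_mul_self U.2, Matrix.one_mul]
    rw [← h]
    simp [hU]
  have htrs : (swapOp N * M).trace = (swapOp N * R).trace := by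
    have h := integral_linearMap_matrix μ F hint
      (Matrix.traceLinearMap _ ℂ ℂ ∘ₗ LinearMap.mulLeft ℂ (swapOp N))
    simp only [LinearMap.comp_apply, LinearMap.mulLeft_apply, Matrix.traceLinearMap_apply] at h
    rw [← hM] at h
    have hU (U : Matrix.unitaryGroup (Fin N) ℂ) :
        (swapOp N * F U).trace = (swapOp N * R).trace := by
      rw [hF, ← Matrix.mul_assoc, ← Matrix.mul_assoc, ← kronecker_self_mul_swapOp,
        Matrix.trace_mul_comm, Matrix.mul_assoc, ← Matrix.mul_assoc,
        kronecker_conjTranspose_mul_self U.2, Matrix.one_mul]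
    rw [← h]
    simp [hU]
  have h₁ : b * (N * N) + c * N = R.trace := by
    rw [← htr, hbc, Matrix.trace_add, Matrix.trace_smul, Matrix.trace_smul, trace_swapOp]
    simp
  have h₂ : b * N + c * (N * N) = (swapOp N * R).trace := by
    rw [← htrs, hbc, Matrix.mul_add, Matrix.mul_smul, Matrix.mul_smul, swapOp_mul_swapOp,
      Matrix.mul_one, Matrix.trace_add, Matrix.trace_smul, Matrix.trace_smul, trace_swapOp]
    simp
  have hN0 : (N : ℂ) ≠ 0 := by norm_cast; omega
  have hN1 : (N : ℂ) + 1 ≠ 0 := by norm_cast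
  have hN2 : (N : ℂ) - 1 ≠ 0 := by
    rw [sub_ne_zero]
    norm_cast
    omega
  have hplus : (Pplus N * R).trace = (b + c) * (N * (N + 1)) / 2 := by
    rw [Pplus, Matrix.smul_mul, Matrix.add_mul, Matrix.one_mul, Matrix.trace_smul,
      Matrix.trace_add, ← h₁, ← h₂, smul_eq_mul]
    ring
  have hminus : (Pminus N * R).trace = (b - c) * (N * (N - 1)) / 2 := by
    rw [Pminus, Matrix.smul_mul, Matrix.sub_mul, Matrix.one_mul, Matrix.trace_smul,
      Matrix.trace_sub, ← h₁, ← h₂, smul_eq_mul]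
    ring
  have e₁ : 2 / ((N : ℂ) * (N + 1)) * ((b + c) * (N * (N + 1)) / 2) = b + c := by field_simp
  have e₂ : 2 / ((N : ℂ) * (N - 1)) * ((b - c) * (N * (N - 1)) / 2) = b - c := by field_simp
  change M p q = _
  rw [hplus, hminus, e₁, e₂, hbc]
  simp only [Pplus, Pminus, Matrix.add_apply, Matrix.sub_apply, Matrix.smul_apply, smul_eq_mul]
  ring
end

section
/- Let N and M be positive integers, let μ be the Haar probability measure on U(N), and let X and Y be arbitrary linear operators on ℂ^N ⊗ ℂ^M. For U ∈ U(N) write Ũ := U ⊗ 1_M and define the Riemannian energy gradient g(U) := Tr_M( Y Ũ X − Ũ X Ũ† Y Ũ ), an operator on ℂ^N. Then the Haar average vanishes: ∫_{U(N)} g(U) dμ(U) = 0. -/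
open Matrix MeasureTheory
open scoped Kronecker

/-- Partial trace over the `ℂ^M` factor of `ℂ^N ⊗ ℂ^M`. -/
noncomputable def ptraceM (N M : ℕ) (A : Matrix (Fin N × Fin M) (Fin N × Fin M) ℂ) :
    Matrix (Fin N) (Fin N) ℂ :=
  fun i j => ∑ s : Fin M, A (i, s) (j, s)

/-- The Riemannian energy gradient `g(U) = Tr_M (Y Ũ X − Ũ X Ũ† Y Ũ)` with `Ũ = U ⊗ 1_M`,
for the energy `E(U) = Tr (X (U†⊗1_M) Y (U⊗1_M))`. -/
noncomputable def riemannGrad (N M : ℕ)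
    (X Y : Matrix (Fin N × Fin M) (Fin N × Fin M) ℂ)
    (U : Matrix.unitaryGroup (Fin N) ℂ) : Matrix (Fin N) (Fin N) ℂ :=
  let Ut : Matrix (Fin N × Fin M) (Fin N × Fin M) ℂ :=
    (U : Matrix (Fin N) (Fin N) ℂ) ⊗ₖ (1 : Matrix (Fin M) (Fin M) ℂ)
  ptraceM N M (Y * Ut * X - Ut * X * Utᴴ * Y * Ut)

theorem riemannGrad_neg (N M : ℕ) (X Y : Matrix (Fin N × Fin M) (Fin N × Fin M) ℂ)
    (U : Matrix.unitaryGroup (Fin N) ℂ) :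
    riemannGrad N M X Y (-U) = -riemannGrad N M X Y U := by
  have h : ((-U : Matrix.unitaryGroup (Fin N) ℂ) : Matrix (Fin N) (Fin N) ℂ) ⊗ₖ
      (1 : Matrix (Fin M) (Fin M) ℂ) = -((U : Matrix (Fin N) (Fin N) ℂ) ⊗ₖ 1) := by
    ext
    simp [Matrix.kroneckerMap_apply, Unitary.coe_neg]
  ext i j
  simp only [riemannGrad, h, ptraceM, Matrix.neg_apply, ← Finset.sum_neg_distrib]
  refine Finset.sum_congr rfl fun s _ => ?_
  simp only [Matrix.conjTranspose_neg, mul_neg, neg_mul, neg_neg, Matrix.sub_apply,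
    Matrix.neg_apply]
  ring

/-- The Haar average of the Riemannian energy gradient vanishes. -/
theorem haar_average_riemannGrad_eq_zero (N M : ℕ) (hN : 0 < N) (hM : 0 < M)
    (μ : Measure (Matrix.unitaryGroup (Fin N) ℂ))
    [μ.IsHaarMeasure] [IsProbabilityMeasure μ]
    (X Y : Matrix (Fin N × Fin M) (Fin N × Fin M) ℂ) (i j : Fin N) :
    ∫ U, riemannGrad N M X Y U i j ∂μ = 0 := by
  have h := integral_mul_left_eq_self (μ := μ) (fun U => riemannGrad N M X Y U i j) (-1)
  simp only [neg_mul, one_mul, riemannGrad_neg, Matrix.neg_apply, integral_neg] at h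
  exact self_eq_neg.mp h.symm
end

section
/- Let N ≥ 2 and M be positive integers, let μ be the Haar probability measure on U(N), and let X and Y be Hermitian operators on ℂ^N ⊗ ℂ^M. For U ∈ U(N) write Ũ := U ⊗ 1_M and define g(U) := Tr_M( Y Ũ X − Ũ X Ũ† Y Ũ ). Define the operator Z on ℂ^N ⊗ ℂ^N by ⟨i₁,i₂| Z |j₁,j₂⟩ = Σ_{m,n=1}^{M} ⟨i₁,m| X |j₁,n⟩ ⟨i₂,n| Y |j₂,m⟩. Then (1/N) ∫_{U(N)} Tr( g(U)† g(U) ) dμ(U) = (2/(N²−1)) · [ Tr(Z²) − (1/N)·Tr( (Tr₁ Z)² + (Tr₂ Z)² ) + (1/N²)·(Tr Z)² ]. -/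
open Matrix MeasureTheory
open scoped Kronecker

/-- The operator `Z` on `ℂ^N ⊗ ℂ^N` with
`⟨i₁,i₂|Z|j₁,j₂⟩ = Σ_{m,n} ⟨i₁,m|X|j₁,n⟩⟨i₂,n|Y|j₂,m⟩`. -/
noncomputable def Zop (N M : ℕ) (X Y : Matrix (Fin N × Fin M) (Fin N × Fin M) ℂ) :
    Matrix (Fin N × Fin N) (Fin N × Fin N) ℂ :=
  fun p q => ∑ m : Fin M, ∑ n : Fin M, X (p.1, m) (q.1, n) * Y (p.2, n) (q.2, m)

/-- Partial trace over the first `ℂ^N` factor of `ℂ^N ⊗ ℂ^N`. -/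
noncomputable def ptr1 (N : ℕ) (Z : Matrix (Fin N × Fin N) (Fin N × Fin N) ℂ) :
    Matrix (Fin N) (Fin N) ℂ :=
  fun i j => ∑ a : Fin N, Z (a, i) (a, j)

/-- Partial trace over the second `ℂ^N` factor of `ℂ^N ⊗ ℂ^N`. -/
noncomputable def ptr2 (N : ℕ) (Z : Matrix (Fin N × Fin N) (Fin N × Fin N) ℂ) :
    Matrix (Fin N) (Fin N) ℂ :=
  fun i j => ∑ b : Fin N, Z (i, b) (j, b)

namespace UnitaryMoments

variable {n : Type*} [Fintype n] [DecidableEq n]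

/-- A four-index tensor invariant under `V ⊗ V ⊗ conj V ⊗ conj V` for every unitary `V`. -/
def IsTwirlInvariant (T : n → n → n → n → ℂ) : Prop :=
  ∀ V ∈ Matrix.unitaryGroup n ℂ, ∀ i j k l,
    T i j k l = ∑ p, ∑ q, ∑ r, ∑ s, V i p * V j q * star (V k r) * star (V l s) * T p q r s

theorem diagonal_update_I_mem_unitaryGroup (x : n) :
    diagonal (Function.update (1 : n → ℂ) x Complex.I) ∈ Matrix.unitaryGroup n ℂ := by
  rw [Matrix.mem_unitaryGroup_iff, star_eq_conjTranspose, diagonal_conjTranspose,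
    diagonal_mul_diagonal, ← diagonal_one]
  congr 1
  ext y
  by_cases h : y = x
  · subst h; simp
  · simp [h]

theorem permMatrix_mem_unitaryGroup (σ : Equiv.Perm n) :
    σ.permMatrix ℂ ∈ Matrix.unitaryGroup n ℂ := by
  rw [Matrix.mem_unitaryGroup_iff, star_eq_conjTranspose, conjTranspose_permMatrix,
    ← permMatrix_mul]
  simp

theorem reflection_mem_unitaryGroup {v : n → ℂ} {c : ℝ} (hc : c ≠ 0)
    (hv : star v ⬝ᵥ v = c) :
    1 - ((2 / c : ℝ) : ℂ) • vecMulVec v (star v) ∈ Matrix.unitaryGroup n ℂ := by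
  rw [Matrix.mem_unitaryGroup_iff, star_eq_conjTranspose]
  simp only [conjTranspose_sub, conjTranspose_one, conjTranspose_smul, conjTranspose_vecMulVec,
    star_star]
  simp only [mul_sub, sub_mul, mul_one, one_mul, smul_mul_assoc, mul_smul_comm,
    vecMulVec_mul_vecMulVec, hv]
  have hc' : (c : ℂ) ≠ 0 := by exact_mod_cast hc
  ext i j
  simp
  field_simp
  ring

namespace IsTwirlInvariant

variable {T : n → n → n → n → ℂ}

theorem eq_zero (hT : IsTwirlInvariant T) {i j k l : n}
    (h : ¬ ((i = k ∧ j = l) ∨ (i = l ∧ j = k))) : T i j k l = 0 := by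
  by_contra hz
  have key : ∀ x, Function.update (1 : n → ℂ) x Complex.I i *
      Function.update (1 : n → ℂ) x Complex.I j *
      star (Function.update (1 : n → ℂ) x Complex.I k) *
      star (Function.update (1 : n → ℂ) x Complex.I l) = 1 := by
    intro x
    have := hT _ (diagonal_update_I_mem_unitaryGroup x) i j k l
    refine mul_right_cancel₀ hz (Eq.trans (Eq.symm ?_) (one_mul _).symm)
    simpa [diagonal_apply, apply_ite star, ite_mul, mul_ite] using this
  have h1 := key i
  have h2 := key j
  clear key
  simp only [Function.update_apply, Pi.one_apply] at h1 h2
  have hI : Complex.I ≠ 1 := by simp [Complex.ext_iff]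
  have hI' : -Complex.I ≠ 1 := by simp [Complex.ext_iff]
  have hn : (-1 : ℂ) ≠ 1 := by norm_num
  split_ifs at h1 h2 <;> simp [hI, hI', hn] at h1 h2 <;> grind

theorem perm (hT : IsTwirlInvariant T) (σ : Equiv.Perm n) (i j k l : n) :
    T (σ i) (σ j) (σ k) (σ l) = T i j k l := by
  have := hT _ (permMatrix_mem_unitaryGroup σ) i j k l
  simpa [Equiv.Perm.permMatrix, PEquiv.toMatrix_apply, apply_ite star, ite_mul, mul_ite,
    eq_comm] using this.symm

theorem diag_eq_add (hT : IsTwirlInvariant T) {i j : n} (hij : i ≠ j) :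
    T i i i i = (T i j i j + T j i j i + T i j j i + T j i i j) / 2 := by
  have hv : star (Pi.single i 1 + Pi.single j 2 : n → ℂ) ⬝ᵥ (Pi.single i 1 + Pi.single j 2) =
      ((5 : ℝ) : ℂ) := by
    simp [hij, hij.symm]
    norm_num
  have hrow : ∀ p, (1 - ((2 / 5 : ℝ) : ℂ) • vecMulVec (Pi.single i 1 + Pi.single j 2 : n → ℂ)
      (star (Pi.single i 1 + Pi.single j 2)) : Matrix n n ℂ) i p =
      (if p = i then 3 / 5 else 0) + (if p = j then -4 / 5 else 0) := by
    intro p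
    by_cases hi : p = i
    · subst hi
      simp [vecMulVec_apply, hij]
      norm_num
    · by_cases hj : p = j
      · subst hj
        simp [vecMulVec_apply, hij, hij.symm]
        norm_num
      · simp [vecMulVec_apply, hi, hj, Ne.symm hi, one_apply]
  have key := hT _ (reflection_mem_unitaryGroup (by norm_num) hv) i i i i
  simp only [hrow] at key
  have hz := fun p q r s => hT.eq_zero (i := p) (j := q) (k := r) (l := s)
  have hjj : T j j j j = T i i i i := by simpa using hT.perm (Equiv.swap i j) i i i i
  simp only [star_add, apply_ite star, star_zero, add_mul, mul_add, ite_mul, mul_ite, zero_mul,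
    mul_zero, Finset.sum_add_distrib, Finset.sum_ite_eq', Finset.mem_univ, if_true] at key
  simp [hjj, hz, hij, hij.symm] at key
  linear_combination (625 / 288) * key

theorem apply_eq_of_ne (hT : IsTwirlInvariant T) {i j i' j' : n} (h : i ≠ j) (h' : i' ≠ j') :
    T i j i j = T i' j' i' j' ∧ T i j j i = T i' j' j' i' := by
  obtain ⟨σ, rfl, rfl⟩ : ∃ σ : Equiv.Perm n, σ i' = i ∧ σ j' = j := by
    refine ⟨Equiv.swap (Equiv.swap i' i j') j * Equiv.swap i' i, ?_, by simp⟩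
    have : i ≠ Equiv.swap i' i j' := fun h => h' <| by
      simpa using congrArg (Equiv.swap i' i) h
    simp [Equiv.swap_apply_of_ne_of_ne this h]
  exact ⟨hT.perm .., hT.perm ..⟩

theorem exists_eq [Nontrivial n] (hT : IsTwirlInvariant T) :
    ∃ α β : ℂ, ∀ i j k l, T i j k l =
      (if i = k ∧ j = l then α else 0) + (if i = l ∧ j = k then β else 0) := by
  obtain ⟨x, y, hxy⟩ := exists_pair_ne n
  refine ⟨T x y x y, T x y y x, fun i j k l => ?_⟩
  by_cases hij : i = j
  · subst hij
    by_cases h : i = k ∧ i = l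
    · obtain ⟨rfl, rfl⟩ := h
      obtain ⟨j, hj⟩ := exists_ne i
      obtain ⟨h1, h2⟩ := hT.apply_eq_of_ne hj hxy
      obtain ⟨h3, h4⟩ := hT.apply_eq_of_ne hj.symm hxy
      rw [hT.diag_eq_add hj.symm, h1, h2, h3, h4]
      simp
      ring
    · rw [hT.eq_zero (by tauto), if_neg h, if_neg (by tauto), add_zero]
  · obtain ⟨h1, h2⟩ := hT.apply_eq_of_ne hij hxy
    rw [← h1, ← h2]
    by_cases h : i = k ∧ j = l
    · obtain ⟨rfl, rfl⟩ := h
      simp [hij]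
    · by_cases h' : i = l ∧ j = k
      · obtain ⟨rfl, rfl⟩ := h'
        simp [hij]
      · rw [hT.eq_zero (by tauto), if_neg h, if_neg h', add_zero]

end IsTwirlInvariant

omit [DecidableEq n] in
theorem conj_mul_apply (A U : Matrix n n ℂ) (a b : n) :
    (Uᴴ * A * U) a b = ∑ i, ∑ j, star (U i a) * A i j * U j b := by
  simp only [Matrix.mul_apply, Finset.sum_mul, conjTranspose_apply]
  exact Finset.sum_comm

section Haar

variable (μ : Measure (Matrix.unitaryGroup n ℂ)) [μ.IsHaarMeasure] [IsProbabilityMeasure μ]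

/-- A fourth moment of the matrix entries. -/
noncomputable def moment (a b c d i j k l : n) : ℂ :=
  ∫ U : Matrix.unitaryGroup n ℂ, U.1 i a * U.1 j b * star (U.1 k c) * star (U.1 l d) ∂μ

omit [μ.IsHaarMeasure] in
theorem integrable_moment (a b c d i j k l : n) :
    Integrable (fun U : Matrix.unitaryGroup n ℂ =>
      U.1 i a * U.1 j b * star (U.1 k c) * star (U.1 l d)) μ := by
  have hc : Continuous (fun U : Matrix.unitaryGroup n ℂ =>
      U.1 i a * U.1 j b * star (U.1 k c) * star (U.1 l d)) := by
    have h : ∀ x y, Continuous fun U : Matrix.unitaryGroup n ℂ => U.1 x y :=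
      fun x y => continuous_subtype_val.matrix_elem x y
    exact (((h i a).mul (h j b)).mul (h k c).star).mul (h l d).star
  refine Integrable.of_bound hc.aestronglyMeasurable 1 (.of_forall fun U => ?_)
  have := fun x y => entry_norm_bound_of_unitary U.2 x y
  simp only [norm_mul, norm_star]
  calc _ ≤ (1 : ℝ) * 1 * 1 * 1 := by gcongr <;> exact this _ _
    _ = 1 := by norm_num

theorem isTwirlInvariant_moment (a b c d : n) : IsTwirlInvariant (moment μ a b c d) := by
  intro V hV i j k l
  have hint := integrable_moment μ a b c d
  have hterm := fun p q r s =>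
    (hint p q r s).const_mul (V i p * V j q * star (V k r) * star (V l s))
  simp only [moment]
  rw [← integral_mul_left_eq_self _ (⟨V, hV⟩ : Matrix.unitaryGroup n ℂ)]
  simp only [← integral_const_mul]
  have hs := fun p q r => integrable_finsetSum Finset.univ fun s _ => hterm p q r s
  have hr := fun p q => integrable_finsetSum Finset.univ fun r _ => hs p q r
  have hq := fun p => integrable_finsetSum Finset.univ fun q _ => hr p q
  simp only [← integral_finsetSum Finset.univ fun s _ => hterm _ _ _ s,
    ← integral_finsetSum Finset.univ fun s _ => hs _ _ s,
    ← integral_finsetSum Finset.univ fun s _ => hr _ s,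
    ← integral_finsetSum Finset.univ fun s _ => hq s]
  congr 1 with U
  have hfactor : ∀ p q r s, V i p * V j q * star (V k r) * star (V l s) *
      (U.1 p a * U.1 q b * star (U.1 r c) * star (U.1 s d)) =
      (V i p * U.1 p a) * (V j q * U.1 q b) * star (V k r * U.1 r c) * star (V l s * U.1 s d) := by
    intro p q r s
    simp only [star_mul']
    ring
  simp only [hfactor, ← Finset.mul_sum, ← Finset.sum_mul, ← star_sum]
  simp [Matrix.mul_apply]

omit [μ.IsHaarMeasure] in
theorem sum_moment_parallel (a b c d : n) :
    ∑ i, ∑ j, moment μ a b c d i j i j = if a = c ∧ b = d then 1 else 0 := by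
  have hint := integrable_moment μ a b c d
  have hs := fun i => integrable_finsetSum Finset.univ fun j _ => hint i j i j
  simp only [moment, ← integral_finsetSum Finset.univ fun j _ => hint _ j _ j,
    ← integral_finsetSum Finset.univ fun i _ => hs i]
  have hU : ∀ U : Matrix.unitaryGroup n ℂ, ∀ x y,
      ∑ i, U.1 i x * star (U.1 i y) = if x = y then 1 else 0 := by
    intro U x y
    have := congrFun₂ (mem_unitaryGroup_iff'.mp U.2) y x
    simpa [star_eq_conjTranspose, Matrix.mul_apply, one_apply, mul_comm, eq_comm] using this
  have hfactor : ∀ (U : Matrix.unitaryGroup n ℂ) (i j : n),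
      U.1 i a * U.1 j b * star (U.1 i c) * star (U.1 j d) =
      (U.1 i a * star (U.1 i c)) * (U.1 j b * star (U.1 j d)) := by
    intros; ring
  simp only [hfactor, ← Finset.mul_sum, ← Finset.sum_mul, hU]
  simp [← ite_and, and_comm]

omit [μ.IsHaarMeasure] in
theorem sum_moment_crossed (a b c d : n) :
    ∑ i, ∑ j, moment μ a b c d i j j i = if a = d ∧ b = c then 1 else 0 := by
  rw [← sum_moment_parallel μ a b d c]
  refine Finset.sum_congr rfl fun i _ => Finset.sum_congr rfl fun j _ => ?_
  simp only [moment]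
  congr 1 with U
  ring

theorem moment_eq [Nontrivial n] (a b c d i j k l : n) :
    moment μ a b c d i j k l =
      (if i = k ∧ j = l then
        ((if a = c ∧ b = d then 1 else 0) - (if a = d ∧ b = c then 1 else 0) / Fintype.card n)
          / ((Fintype.card n : ℂ) ^ 2 - 1) else 0) +
      (if i = l ∧ j = k then
        ((if a = d ∧ b = c then 1 else 0) - (if a = c ∧ b = d then 1 else 0) / Fintype.card n)
          / ((Fintype.card n : ℂ) ^ 2 - 1) else 0) := by
  obtain ⟨α, β, h⟩ := (isTwirlInvariant_moment μ a b c d).exists_eq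
  have h1 := sum_moment_parallel μ a b c d
  have h2 := sum_moment_crossed μ a b c d
  have hcard : (1 : ℝ) < Fintype.card n := by exact_mod_cast Fintype.one_lt_card
  have h0 : (Fintype.card n : ℂ) ≠ 0 := by
    exact_mod_cast (zero_lt_one.trans hcard).ne'
  have h3 : (Fintype.card n : ℂ) ^ 2 - 1 ≠ 0 := by
    have : (Fintype.card n : ℝ) ^ 2 - 1 ≠ 0 := by nlinarith
    exact_mod_cast this
  rw [h]
  generalize (if a = c ∧ b = d then (1 : ℂ) else 0) = δ at h1 h2 ⊢
  generalize (if a = d ∧ b = c then (1 : ℂ) else 0) = ε at h1 h2 ⊢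
  simp [h, Finset.sum_add_distrib, ite_and] at h1 h2
  subst h1 h2
  congr 2 <;> field_simp <;> ring

omit [μ.IsHaarMeasure] in
theorem hasIntegral_conj_mul_conj (A B : Matrix n n ℂ) (a b c d : n) :
    Integrable (fun U : Matrix.unitaryGroup n ℂ =>
      (U.1ᴴ * A * U.1) a b * (U.1ᴴ * B * U.1) c d) μ ∧
    ∫ U : Matrix.unitaryGroup n ℂ, (U.1ᴴ * A * U.1) a b * (U.1ᴴ * B * U.1) c d ∂μ =
      ∑ i, ∑ j, ∑ k, ∑ l, A i j * B k l * moment μ b d a c j l i k := by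
  have hexp : (fun U : Matrix.unitaryGroup n ℂ =>
      (U.1ᴴ * A * U.1) a b * (U.1ᴴ * B * U.1) c d) = fun U => ∑ i, ∑ j, ∑ k, ∑ l,
        A i j * B k l * (U.1 j b * U.1 l d * star (U.1 i a) * star (U.1 k c)) := by
    ext U
    rw [conj_mul_apply, conj_mul_apply]
    have hfactor : ∀ i j k l,
        A i j * B k l * (U.1 j b * U.1 l d * star (U.1 i a) * star (U.1 k c)) =
        (star (U.1 i a) * A i j * U.1 j b) * (star (U.1 k c) * B k l * U.1 l d) := by
      intros; ring
    simp only [hfactor, ← Finset.mul_sum, ← Finset.sum_mul]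
  have hl := fun i j k l => (integrable_moment μ b d a c j l i k).const_mul (A i j * B k l)
  have hk := fun i j k => integrable_finsetSum Finset.univ fun l _ => hl i j k l
  have hj := fun i j => integrable_finsetSum Finset.univ fun k _ => hk i j k
  have hi := fun i => integrable_finsetSum Finset.univ fun j _ => hj i j
  rw [hexp]
  refine ⟨integrable_finsetSum Finset.univ fun i _ => hi i, ?_⟩
  simp only [moment, ← integral_const_mul, ← integral_finsetSum Finset.univ fun s _ => hl _ _ _ s,
    ← integral_finsetSum Finset.univ fun s _ => hk _ _ s,
    ← integral_finsetSum Finset.univ fun s _ => hj _ s,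
    ← integral_finsetSum Finset.univ fun s _ => hi s]

theorem integral_conj_mul_conj [Nontrivial n] (A B : Matrix n n ℂ) (a b c d : n) :
    ∫ U : Matrix.unitaryGroup n ℂ, (U.1ᴴ * A * U.1) a b * (U.1ᴴ * B * U.1) c d ∂μ =
      (((if a = b ∧ c = d then 1 else 0) - (if a = d ∧ b = c then 1 else 0) / Fintype.card n)
          * (A.trace * B.trace)
        + ((if a = d ∧ b = c then 1 else 0) - (if a = b ∧ c = d then 1 else 0) / Fintype.card n)
          * (A * B).trace) / ((Fintype.card n : ℂ) ^ 2 - 1) := by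
  rw [(hasIntegral_conj_mul_conj μ A B a b c d).2]
  simp only [moment_eq, show (b = a ∧ d = c ↔ a = b ∧ c = d) by tauto,
    show (b = c ∧ d = a ↔ a = d ∧ b = c) by tauto]
  simp [mul_add, Finset.sum_add_distrib, ite_and, trace, Matrix.mul_apply, Finset.sum_mul_sum]
  simp only [← Finset.sum_mul]
  ring

theorem hasIntegral_sum_conj_mul_conj [Nontrivial n] {ι : Type*} [Fintype ι]
    (A B : ι → Matrix n n ℂ) (a b c d : ι → n) :
    Integrable (fun U : Matrix.unitaryGroup n ℂ =>
      ∑ x, (U.1ᴴ * A x * U.1) (a x) (b x) * (U.1ᴴ * B x * U.1) (c x) (d x)) μ ∧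
    ∫ U : Matrix.unitaryGroup n ℂ,
      ∑ x, (U.1ᴴ * A x * U.1) (a x) (b x) * (U.1ᴴ * B x * U.1) (c x) (d x) ∂μ =
      ((∑ x, if a x = b x ∧ c x = d x then (A x).trace * (B x).trace else 0)
        - (∑ x, if a x = d x ∧ b x = c x then (A x).trace * (B x).trace else 0) / Fintype.card n
        + (∑ x, if a x = d x ∧ b x = c x then (A x * B x).trace else 0)
        - (∑ x, if a x = b x ∧ c x = d x then (A x * B x).trace else 0) / Fintype.card n)
          / ((Fintype.card n : ℂ) ^ 2 - 1) := by
  have hint := fun x =>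
    (hasIntegral_conj_mul_conj μ (A x) (B x) (a x) (b x) (c x) (d x)).1
  refine ⟨integrable_finsetSum _ fun x _ => hint x, ?_⟩
  rw [integral_finsetSum _ fun x _ => hint x]
  simp only [integral_conj_mul_conj, Finset.sum_div, ← Finset.sum_sub_distrib,
    ← Finset.sum_add_distrib]
  refine Finset.sum_congr rfl fun x _ => ?_
  split_ifs <;> ring

end Haar

section Blocks

/-- The block of `Z` at `(a, b)` with respect to the first tensor factor. -/
def block {m : Type*} (Z : Matrix (m × n) (m × n) ℂ) (a b : m) : Matrix n n ℂ :=
  of fun i j => Z (a, i) (b, j)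

/-- The partial trace of `(U† Y U) X`, in terms of the blocks of `Z`. -/
noncomputable def leftContraction (Z : Matrix (n × n) (n × n) ℂ) (U : Matrix n n ℂ) :
    Matrix n n ℂ :=
  of fun a b => ∑ c, (Uᴴ * block Z c b * U) a c

/-- The partial trace of `X (U† Y U)`, in terms of the blocks of `Z`. -/
noncomputable def rightContraction (Z : Matrix (n × n) (n × n) ℂ) (U : Matrix n n ℂ) :
    Matrix n n ℂ :=
  of fun a b => ∑ c, (Uᴴ * block Z a c * U) c b

omit [DecidableEq n] in
theorem sum_trace_block_mul_block (Z : Matrix (n × n) (n × n) ℂ) :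
    ∑ a, ∑ b, (block Z a b * block Z b a).trace = (Z * Z).trace := by
  simp only [trace, diag_apply, Matrix.mul_apply, Fintype.sum_prod_type, block, of_apply]
  exact Finset.sum_congr rfl fun _ _ => Finset.sum_comm

variable [Nontrivial n] (μ : Measure (Matrix.unitaryGroup n ℂ)) [μ.IsHaarMeasure]
  [IsProbabilityMeasure μ] (Z : Matrix (n × n) (n × n) ℂ)

theorem hasIntegral_leftContraction_sq :
    Integrable (fun U : Matrix.unitaryGroup n ℂ =>
      (leftContraction Z U.1 * leftContraction Z U.1).trace) μ ∧
    ∫ U : Matrix.unitaryGroup n ℂ, (leftContraction Z U.1 * leftContraction Z U.1).trace ∂μ =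
      ((∑ a, ∑ b, (block Z a b).trace * (block Z b a).trace)
        - (∑ a, ∑ b, (block Z a a).trace * (block Z b b).trace) / Fintype.card n
        + (∑ a, ∑ b, (block Z a a * block Z b b).trace)
        - (∑ a, ∑ b, (block Z a b * block Z b a).trace) / Fintype.card n)
          / ((Fintype.card n : ℂ) ^ 2 - 1) := by
  have h := hasIntegral_sum_conj_mul_conj μ (ι := n × n × n × n)
    (fun x => block Z x.2.2.1 x.2.1) (fun x => block Z x.2.2.2 x.1)
    (fun x => x.1) (fun x => x.2.2.1) (fun x => x.2.1) (fun x => x.2.2.2)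
  simp only [Fintype.sum_prod_type] at h
  have hexp : ∀ U : Matrix n n ℂ, (leftContraction Z U * leftContraction Z U).trace =
      ∑ a, ∑ b, ∑ c, ∑ d, (Uᴴ * block Z c b * U) a c * (Uᴴ * block Z d a * U) b d := by
    intro U
    simp only [leftContraction, trace, diag_apply, Matrix.mul_apply (M := of _),
      of_apply, Finset.sum_mul_sum]
  simp only [hexp]
  refine ⟨h.1, h.2.trans ?_⟩
  simp [ite_and]
  rw [Finset.sum_comm (f := fun a b => (block Z b b).trace * (block Z a a).trace),
    Finset.sum_comm (f := fun a b => (block Z b b * block Z a a).trace)]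

theorem hasIntegral_rightContraction_sq :
    Integrable (fun U : Matrix.unitaryGroup n ℂ =>
      (rightContraction Z U.1 * rightContraction Z U.1).trace) μ ∧
    ∫ U : Matrix.unitaryGroup n ℂ, (rightContraction Z U.1 * rightContraction Z U.1).trace ∂μ =
      ((∑ a, ∑ b, (block Z a b).trace * (block Z b a).trace)
        - (∑ a, ∑ b, (block Z a a).trace * (block Z b b).trace) / Fintype.card n
        + (∑ a, ∑ b, (block Z a a * block Z b b).trace)
        - (∑ a, ∑ b, (block Z a b * block Z b a).trace) / Fintype.card n)
          / ((Fintype.card n : ℂ) ^ 2 - 1) := by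
  have h := hasIntegral_sum_conj_mul_conj μ (ι := n × n × n × n)
    (fun x => block Z x.1 x.2.2.1) (fun x => block Z x.2.1 x.2.2.2)
    (fun x => x.2.2.1) (fun x => x.2.1) (fun x => x.2.2.2) (fun x => x.1)
  simp only [Fintype.sum_prod_type] at h
  have hexp : ∀ U : Matrix n n ℂ, (rightContraction Z U * rightContraction Z U).trace =
      ∑ a, ∑ b, ∑ c, ∑ d, (Uᴴ * block Z a c * U) c b * (Uᴴ * block Z b d * U) d a := by
    intro U
    simp only [rightContraction, trace, diag_apply, Matrix.mul_apply (M := of _),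
      of_apply, Finset.sum_mul_sum]
  simp only [hexp]
  refine ⟨h.1, h.2.trans ?_⟩
  simp [ite_and]

theorem hasIntegral_leftContraction_mul_rightContraction :
    Integrable (fun U : Matrix.unitaryGroup n ℂ =>
      (leftContraction Z U.1 * rightContraction Z U.1).trace) μ ∧
    ∫ U : Matrix.unitaryGroup n ℂ, (leftContraction Z U.1 * rightContraction Z U.1).trace ∂μ =
      ((Fintype.card n : ℂ) - 1 / Fintype.card n) *
        (∑ a, ∑ b, (block Z a b * block Z b a).trace) / ((Fintype.card n : ℂ) ^ 2 - 1) := by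
  have h := hasIntegral_sum_conj_mul_conj μ (ι := n × n × n × n)
    (fun x => block Z x.2.2.1 x.2.1) (fun x => block Z x.2.1 x.2.2.2)
    (fun x => x.1) (fun x => x.2.2.1) (fun x => x.2.2.2) (fun x => x.1)
  simp only [Fintype.sum_prod_type] at h
  have hexp : ∀ U : Matrix n n ℂ, (leftContraction Z U * rightContraction Z U).trace =
      ∑ a, ∑ b, ∑ c, ∑ d, (Uᴴ * block Z c b * U) a c * (Uᴴ * block Z b d * U) d a := by
    intro U
    simp only [leftContraction, rightContraction, trace, diag_apply, Matrix.mul_apply (M := of _),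
      of_apply, Finset.sum_mul_sum]
  simp only [hexp]
  refine ⟨h.1, h.2.trans ?_⟩
  simp [ite_and]
  rw [Finset.sum_comm (f := fun a b => (block Z b a).trace * (block Z a b).trace),
    Finset.sum_comm (f := fun a b => (block Z b a * block Z a b).trace)]
  ring

end Blocks

end UnitaryMoments

section Gradient

open UnitaryMoments

variable {N M : ℕ} (X Y : Matrix (Fin N × Fin M) (Fin N × Fin M) ℂ)

theorem ptraceM_sub (A B : Matrix (Fin N × Fin M) (Fin N × Fin M) ℂ) :
    ptraceM N M (A - B) = ptraceM N M A - ptraceM N M B := by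
  ext i j
  simp [ptraceM]

theorem ptraceM_kronecker_one_mul (A : Matrix (Fin N) (Fin N) ℂ)
    (B : Matrix (Fin N × Fin M) (Fin N × Fin M) ℂ) :
    ptraceM N M ((A ⊗ₖ (1 : Matrix (Fin M) (Fin M) ℂ)) * B) = A * ptraceM N M B := by
  ext i j
  simp [ptraceM, Matrix.mul_apply, Fintype.sum_prod_type, one_apply, Finset.mul_sum]
  exact Finset.sum_comm

theorem conjTranspose_ptraceM (A : Matrix (Fin N × Fin M) (Fin N × Fin M) ℂ) :
    (ptraceM N M A)ᴴ = ptraceM N M Aᴴ := by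
  ext i j
  simp [ptraceM]

theorem kronecker_conj_apply (U : Matrix (Fin N) (Fin N) ℂ) (a c : Fin N) (s t : Fin M) :
    ((U ⊗ₖ (1 : Matrix (Fin M) (Fin M) ℂ))ᴴ * Y * (U ⊗ₖ (1 : Matrix (Fin M) (Fin M) ℂ)))
      (a, s) (c, t) = (Uᴴ * Y.submatrix (·, s) (·, t) * U) a c := by
  simp [Matrix.mul_apply, Fintype.sum_prod_type, one_apply, apply_ite]

theorem block_Zop (a b : Fin N) :
    block (Zop N M X Y) a b =
      ∑ m, ∑ n, X (a, m) (b, n) • Y.submatrix (·, n) (·, m) := by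
  ext i j
  simp [block, Zop, Matrix.sum_apply]

theorem ptraceM_conj_mul (U : Matrix (Fin N) (Fin N) ℂ) :
    ptraceM N M ((U ⊗ₖ (1 : Matrix (Fin M) (Fin M) ℂ))ᴴ * Y *
      (U ⊗ₖ (1 : Matrix (Fin M) (Fin M) ℂ)) * X) = leftContraction (Zop N M X Y) U := by
  ext a b
  simp only [ptraceM, leftContraction, of_apply, block_Zop, Finset.mul_sum, Finset.sum_mul,
    Matrix.sum_apply, Matrix.mul_smul, Matrix.smul_mul, Matrix.smul_apply, smul_eq_mul]
  simp only [Matrix.mul_apply (N := X), Fintype.sum_prod_type, kronecker_conj_apply]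
  rw [Finset.sum_comm]
  refine Finset.sum_congr rfl fun c _ => ?_
  rw [Finset.sum_comm]
  simp only [mul_comm]

theorem ptraceM_mul_conj (U : Matrix (Fin N) (Fin N) ℂ) :
    ptraceM N M (X * ((U ⊗ₖ (1 : Matrix (Fin M) (Fin M) ℂ))ᴴ * Y *
      (U ⊗ₖ (1 : Matrix (Fin M) (Fin M) ℂ)))) = rightContraction (Zop N M X Y) U := by
  ext a b
  simp only [ptraceM, rightContraction, of_apply, block_Zop, Finset.mul_sum, Finset.sum_mul,
    Matrix.sum_apply, Matrix.mul_smul, Matrix.smul_mul, Matrix.smul_apply, smul_eq_mul]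
  simp only [Matrix.mul_apply (M := X), Fintype.sum_prod_type, kronecker_conj_apply]
  exact Finset.sum_comm

theorem riemannGrad_eq (U : Matrix.unitaryGroup (Fin N) ℂ) :
    riemannGrad N M X Y U =
      U.1 * (leftContraction (Zop N M X Y) U.1 - rightContraction (Zop N M X Y) U.1) := by
  have hU : U.1 ⊗ₖ (1 : Matrix (Fin M) (Fin M) ℂ) *
      (U.1 ⊗ₖ (1 : Matrix (Fin M) (Fin M) ℂ))ᴴ = 1 := by
    rw [conjTranspose_kronecker, ← mul_kronecker_mul, ← star_eq_conjTranspose U.1,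
      mem_unitaryGroup_iff.mp U.2]
    simp
  rw [← ptraceM_conj_mul, ← ptraceM_mul_conj, ← ptraceM_sub, ← ptraceM_kronecker_one_mul]
  simp only [riemannGrad, mul_sub, ← mul_assoc, hU, one_mul]

variable {X Y}

theorem trace_riemannGrad_sq (hX : X.IsHermitian) (hY : Y.IsHermitian)
    (U : Matrix.unitaryGroup (Fin N) ℂ) :
    ((riemannGrad N M X Y U)ᴴ * riemannGrad N M X Y U).trace =
      2 * (leftContraction (Zop N M X Y) U.1 * rightContraction (Zop N M X Y) U.1).trace
      - (leftContraction (Zop N M X Y) U.1 * leftContraction (Zop N M X Y) U.1).trace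
      - (rightContraction (Zop N M X Y) U.1 * rightContraction (Zop N M X Y) U.1).trace := by
  have hLR : (leftContraction (Zop N M X Y) U.1)ᴴ = rightContraction (Zop N M X Y) U.1 := by
    rw [← ptraceM_conj_mul, ← ptraceM_mul_conj, conjTranspose_ptraceM]
    simp only [conjTranspose_mul, conjTranspose_conjTranspose, hX.eq, hY.eq, mul_assoc]
  have hRL : (rightContraction (Zop N M X Y) U.1)ᴴ = leftContraction (Zop N M X Y) U.1 := by
    rw [← hLR, conjTranspose_conjTranspose]
  rw [riemannGrad_eq, conjTranspose_mul, mul_assoc, ← mul_assoc U.1ᴴ, ← star_eq_conjTranspose U.1,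
    mem_unitaryGroup_iff'.mp U.2, one_mul, conjTranspose_sub, hLR, hRL]
  simp only [mul_sub, sub_mul, trace_sub]
  rw [trace_mul_comm (rightContraction _ _) (leftContraction _ _)]
  ring

end Gradient

section Assembly

open UnitaryMoments

variable {N : ℕ} (Z : Matrix (Fin N × Fin N) (Fin N × Fin N) ℂ)

theorem sum_trace_block_mul_trace_block :
    ∑ a, ∑ b, (block Z a b).trace * (block Z b a).trace = (ptr2 N Z * ptr2 N Z).trace := by
  simp only [trace, diag_apply, Matrix.mul_apply, block, of_apply, ptr2]

theorem sum_trace_block_diag_mul_block_diag :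
    ∑ a, ∑ b, (block Z a a * block Z b b).trace = (ptr1 N Z * ptr1 N Z).trace := by
  have h : ptr1 N Z = ∑ a, block Z a a := by
    ext i j
    simp [ptr1, block, Matrix.sum_apply]
  simp only [h, Finset.sum_mul_sum, trace_sum]

theorem sum_trace_block_diag_mul_trace_block_diag :
    ∑ a, ∑ b, (block Z a a).trace * (block Z b b).trace = Z.trace ^ 2 := by
  rw [sq, ← Finset.sum_mul_sum]
  simp only [trace, diag_apply, block, of_apply, Fintype.sum_prod_type]

end Assembly

/-- Haar-variance of the Riemannian gradient for `E(U) = Tr(X (U†⊗1_M) Y (U⊗1_M))` with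
Hermitian `X`, `Y`:
`(1/N) ∫ Tr(g†g) dμ = (2/(N²−1)) [Tr(Z²) − (1/N) Tr((Tr₁Z)² + (Tr₂Z)²) + (1/N²) (Tr Z)²]`. -/
theorem riemannGrad_variance_general (N M : ℕ) (hN : 2 ≤ N) (hM : 0 < M)
    (μ : Measure (Matrix.unitaryGroup (Fin N) ℂ))
    [μ.IsHaarMeasure] [IsProbabilityMeasure μ]
    (X Y : Matrix (Fin N × Fin M) (Fin N × Fin M) ℂ)
    (hX : X.IsHermitian) (hY : Y.IsHermitian) :
    (1 / (N : ℂ)) * ∫ U, ((riemannGrad N M X Y U)ᴴ * riemannGrad N M X Y U).trace ∂μ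
      = (2 / ((N : ℂ) ^ 2 - 1)) *
          ((Zop N M X Y * Zop N M X Y).trace
            - (1 / (N : ℂ)) *
                ((ptr1 N (Zop N M X Y) * ptr1 N (Zop N M X Y)).trace
                  + (ptr2 N (Zop N M X Y) * ptr2 N (Zop N M X Y)).trace)
            + (1 / (N : ℂ) ^ 2) * (Zop N M X Y).trace ^ 2) := by
  have : Nontrivial (Fin N) := Fin.nontrivial_iff_two_le.mpr hN
  obtain ⟨hLL, eLL⟩ := UnitaryMoments.hasIntegral_leftContraction_sq μ (Zop N M X Y)
  obtain ⟨hRR, eRR⟩ := UnitaryMoments.hasIntegral_rightContraction_sq μ (Zop N M X Y)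
  obtain ⟨hLR, eLR⟩ :=
    UnitaryMoments.hasIntegral_leftContraction_mul_rightContraction μ (Zop N M X Y)
  simp only [trace_riemannGrad_sq hX hY]
  rw [integral_sub ?_ hRR, integral_sub (hLR.const_mul 2) hLL,
    integral_const_mul, eLL, eRR, eLR]
  simp only [sum_trace_block_mul_trace_block, sum_trace_block_diag_mul_block_diag,
    sum_trace_block_diag_mul_trace_block_diag, UnitaryMoments.sum_trace_block_mul_block,
    Fintype.card_fin]
  have hN0 : (N : ℂ) ≠ 0 := by
    exact_mod_cast (by omega : N ≠ 0)
  have hN1 : (N : ℂ) ^ 2 - 1 ≠ 0 := by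
    rw [sub_ne_zero]
    exact_mod_cast (by nlinarith : N ^ 2 ≠ 1)
  · field_simp
    ring
  · exact (hLR.const_mul 2).sub hLL
end

section
/- (Theorem 1: barren plateau for a global unitary.) Let d ≥ 2 and L ≥ 1 be integers, set N := d^L, let μ be the Haar probability measure on U(N), let H be a Hermitian operator on ℂ^N with Tr H = 0, and let |0⟩ be a unit vector in ℂ^N. Define the Riemannian gradient of the energy E(U) = ⟨0| U† H U |0⟩ as g(U) := H U |0⟩⟨0| − U |0⟩⟨0| U† H U. Then ∫_{U(N)} g(U) dμ(U) = 0 and (1/N) ∫_{U(N)} Tr( g(U)† g(U) ) dμ(U) = 2 Tr(H²) / (N(N+1)) = 2 Tr(H²) / (d^L (d^L + 1)); in particular the gradient variance decays exponentially in the number of sites L. -/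
open Matrix MeasureTheory

/-- The Riemannian gradient `g(U) = H U |0⟩⟨0| − U |0⟩⟨0| U† H U` of the energy
`E(U) = ⟨0|U† H U|0⟩` for the globally parametrized state `|Ψ⟩ = U|0⟩`. -/
noncomputable def globalGrad (N : ℕ) (H : Matrix (Fin N) (Fin N) ℂ) (v : Fin N → ℂ)
    (U : Matrix.unitaryGroup (Fin N) ℂ) : Matrix (Fin N) (Fin N) ℂ :=
  H * (U : Matrix (Fin N) (Fin N) ℂ) * Matrix.vecMulVec v (star v) -
    (U : Matrix (Fin N) (Fin N) ℂ) * Matrix.vecMulVec v (star v) *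
      ((U : Matrix (Fin N) (Fin N) ℂ))ᴴ * H * (U : Matrix (Fin N) (Fin N) ℂ)

section HaarMoments

variable {n : Type*} [Fintype n] [DecidableEq n]

instance compactSpace_unitaryGroup : CompactSpace (Matrix.unitaryGroup n ℂ) := by
  have hball : IsCompact (Set.univ.pi fun _ => Set.univ.pi fun _ => Metric.closedBall 0 1 :
      Set (Matrix n n ℂ)) :=
    isCompact_univ_pi fun _ => isCompact_univ_pi fun _ => isCompact_closedBall 0 1
  refine isCompact_iff_compactSpace.mp
    (hball.of_isClosed_subset (isClosed_unitary (R := Matrix n n ℂ)) ?_)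
  intro U hU i _ j _
  simpa using entry_norm_bound_of_unitary hU i j

theorem exists_unitaryGroup_mulVec_single (w : n → ℂ) (hw : star w ⬝ᵥ w = 1) (i : n) :
    ∃ W : Matrix.unitaryGroup n ℂ, (W : Matrix n n ℂ) *ᵥ Pi.single i 1 = w := by
  have hon : Orthonormal ℂ
      (Set.domRestrict {i} fun _ : n => (WithLp.toLp 2 w : EuclideanSpace ℂ n)) := by
    rw [orthonormal_iff_ite]
    rintro ⟨a, ha⟩ ⟨b, hb⟩
    obtain rfl : a = i := ha
    obtain rfl : b = a := hb
    simpa [-inner_self_eq_norm_sq_to_K, EuclideanSpace.inner_eq_star_dotProduct,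
      dotProduct_comm] using hw
  obtain ⟨b, hb⟩ := hon.exists_orthonormalBasis_extension_of_card_eq (by simp)
  refine ⟨⟨(EuclideanSpace.basisFun n ℂ).toBasis.toMatrix b.toBasis,
    (EuclideanSpace.basisFun n ℂ).toMatrix_orthonormalBasis_mem_unitary b⟩, ?_⟩
  ext k
  simp [Module.Basis.toMatrix_apply, hb i rfl]

theorem sum_normSq_unitary_mulVec (U : Matrix.unitaryGroup n ℂ) (v : n → ℂ) :
    ∑ i, Complex.normSq (((U : Matrix n n ℂ) *ᵥ v) i) = ∑ i, Complex.normSq (v i) := by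
  have key (w : n → ℂ) : ((∑ i, Complex.normSq (w i) : ℝ) : ℂ) = star w ⬝ᵥ w := by
    simp [dotProduct, Complex.normSq_eq_conj_mul_self]
  apply Complex.ofReal_injective
  rw [key, key, star_mulVec, ← dotProduct_mulVec, mulVec_mulVec, ← star_eq_conjTranspose,
    Unitary.coe_star_mul_self, one_mulVec]

theorem continuous_unitaryGroup_mulVec_apply (v : n → ℂ) (i : n) :
    Continuous fun U : Matrix.unitaryGroup n ℂ => ((U : Matrix n n ℂ) *ᵥ v) i :=
  (continuous_apply i).comp (continuous_subtype_val.matrix_mulVec continuous_const)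

variable (μ : Measure (Matrix.unitaryGroup n ℂ)) [μ.IsHaarMeasure]

theorem Continuous.integrable_unitaryGroup {E : Type*} [NormedAddCommGroup E]
    {f : Matrix.unitaryGroup n ℂ → E} (hf : Continuous f) : Integrable f μ :=
  hf.integrable_of_hasCompactSupport (HasCompactSupport.of_compactSpace f)

theorem integrable_normSq_mulVec_mul_normSq_mulVec (v : n → ℂ) (i j : n) :
    Integrable (fun U : Matrix.unitaryGroup n ℂ =>
      Complex.normSq (((U : Matrix n n ℂ) *ᵥ v) i) *
        Complex.normSq (((U : Matrix n n ℂ) *ᵥ v) j)) μ :=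
  Continuous.integrable_unitaryGroup μ <|
    (Complex.continuous_normSq.comp (continuous_unitaryGroup_mulVec_apply v i)).mul
      (Complex.continuous_normSq.comp (continuous_unitaryGroup_mulVec_apply v j))

/-- By left invariance, the fourth moment of an overlap `⟨w, U v⟩` does not depend on
the unit vector `w`. -/
theorem integral_normSq_dotProduct_sq (v w : n → ℂ) (hw : star w ⬝ᵥ w = 1) (i : n) :
    ∫ U : Matrix.unitaryGroup n ℂ,
        Complex.normSq (star w ⬝ᵥ ((U : Matrix n n ℂ) *ᵥ v)) ^ 2 ∂μ =
      ∫ U : Matrix.unitaryGroup n ℂ, Complex.normSq (((U : Matrix n n ℂ) *ᵥ v) i) ^ 2 ∂μ := by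
  obtain ⟨W, rfl⟩ := exists_unitaryGroup_mulVec_single w hw i
  rw [← integral_mul_left_eq_self _ W]
  congr 1
  ext U
  congr 2
  rw [star_mulVec, ← dotProduct_mulVec, Submonoid.coe_mul, mulVec_mulVec, ← Matrix.mul_assoc,
    ← star_eq_conjTranspose, Unitary.coe_star_mul_self, Matrix.one_mul]
  simp

theorem integral_normSq_mulVec_sq_eq_two_mul (v : n → ℂ) {i j : n} (hij : i ≠ j) :
    ∫ U : Matrix.unitaryGroup n ℂ, Complex.normSq (((U : Matrix n n ℂ) *ᵥ v) i) ^ 2 ∂μ =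
      2 * ∫ U : Matrix.unitaryGroup n ℂ, Complex.normSq (((U : Matrix n n ℂ) *ᵥ v) i) *
        Complex.normSq (((U : Matrix n n ℂ) *ᵥ v) j) ∂μ := by
  have hcont : ∀ c : ℂ, Continuous fun U : Matrix.unitaryGroup n ℂ =>
      Complex.normSq (((U : Matrix n n ℂ) *ᵥ v) i + c * ((U : Matrix n n ℂ) *ᵥ v) j) ^ 2 :=
    fun c => (Complex.continuous_normSq.comp ((continuous_unitaryGroup_mulVec_apply v i).add
      (continuous_const.mul (continuous_unitaryGroup_mulVec_apply v j)))).pow 2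
  have hrot : ∀ c : ℂ, Complex.normSq c = 1 →
      ∫ U : Matrix.unitaryGroup n ℂ,
        Complex.normSq (((U : Matrix n n ℂ) *ᵥ v) i + c * ((U : Matrix n n ℂ) *ᵥ v) j) ^ 2 ∂μ =
      4 * ∫ U : Matrix.unitaryGroup n ℂ, Complex.normSq (((U : Matrix n n ℂ) *ᵥ v) i) ^ 2 ∂μ := by
    intro c hc
    have hs : ((√2 : ℝ) : ℂ) * (√2 : ℝ) = 2 := by
      rw [← Complex.ofReal_mul]; norm_num
    have hs0 : ((√2 : ℝ) : ℂ) ≠ 0 := by simp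
    have hcc : c * star c = 1 := by
      rw [Complex.star_def, Complex.mul_conj, hc, Complex.ofReal_one]
    rw [← integral_normSq_dotProduct_sq μ v
      (((√2 : ℝ) : ℂ)⁻¹ • (Pi.single i 1 + Pi.single j (star c))) ?_ i, ← integral_const_mul]
    · congr 1
      ext U
      simp only [star_smul, star_add, ← Pi.single_star, smul_dotProduct, add_dotProduct,
        single_dotProduct, star_one, one_mul, smul_eq_mul, Complex.normSq_mul,
        star_inv₀, Complex.star_def, Complex.conj_ofReal, Complex.normSq_inv,
        Complex.normSq_ofReal]
      norm_num
      ring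
    · simp only [star_smul, star_add, ← Pi.single_star, smul_dotProduct, add_dotProduct,
        single_dotProduct, star_one, one_mul, smul_eq_mul, dotProduct_smul,
        star_inv₀, Complex.star_def, Complex.conj_ofReal, Pi.add_apply, Pi.single_eq_same,
        Pi.single_eq_of_ne hij, Pi.single_eq_of_ne hij.symm]
      rw [Complex.star_def] at hcc
      field_simp
      simp only [Complex.conj_conj]
      linear_combination hcc - hs
  have hpol : ∀ x y : ℂ,
      Complex.normSq (x + 1 * y) ^ 2 + Complex.normSq (x + -1 * y) ^ 2 +
        (Complex.normSq (x + Complex.I * y) ^ 2 + Complex.normSq (x + -Complex.I * y) ^ 2) =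
      4 * Complex.normSq x ^ 2 + 4 * Complex.normSq y ^ 2 +
        16 * (Complex.normSq x * Complex.normSq y) := by
    intro x y
    simp [Complex.normSq_apply]
    ring
  have hint := integral_congr_ae (μ := μ) (Filter.Eventually.of_forall
    fun U : Matrix.unitaryGroup n ℂ =>
      hpol (((U : Matrix n n ℂ) *ᵥ v) i) (((U : Matrix n n ℂ) *ᵥ v) j))
  have h1 := (hcont 1).integrable_unitaryGroup μ
  have h2 := (hcont (-1)).integrable_unitaryGroup μ
  have h3 := (hcont Complex.I).integrable_unitaryGroup μ
  have h4 := (hcont (-Complex.I)).integrable_unitaryGroup μ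
  have hsq := fun k => (integrable_normSq_mulVec_mul_normSq_mulVec μ v k k).const_mul 4
  simp only [← sq] at hsq
  have hm := (integrable_normSq_mulVec_mul_normSq_mulVec μ v i j).const_mul 16
  have hji : ∫ U : Matrix.unitaryGroup n ℂ, Complex.normSq (((U : Matrix n n ℂ) *ᵥ v) j) ^ 2 ∂μ =
      ∫ U : Matrix.unitaryGroup n ℂ, Complex.normSq (((U : Matrix n n ℂ) *ᵥ v) i) ^ 2 ∂μ := by
    rw [← integral_normSq_dotProduct_sq μ v (Pi.single j 1) (by simp) i]
    simp
  rw [integral_add (h1.fun_add h2) (h3.fun_add h4), integral_add h1 h2, integral_add h3 h4,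
    integral_add ((hsq i).fun_add (hsq j)) hm, integral_add (hsq i) (hsq j), integral_const_mul, integral_const_mul,
    integral_const_mul, hrot 1 (by simp), hrot (-1) (by simp), hrot Complex.I (by simp),
    hrot (-Complex.I) (by simp), hji] at hint
  linarith

theorem integral_normSq_mulVec_mul_normSq_mulVec [IsProbabilityMeasure μ] (v : n → ℂ)
    (hv : ∑ k, Complex.normSq (v k) = 1) {i j : n} (hij : i ≠ j) :
    ∫ U : Matrix.unitaryGroup n ℂ, Complex.normSq (((U : Matrix n n ℂ) *ᵥ v) i) *
        Complex.normSq (((U : Matrix n n ℂ) *ᵥ v) j) ∂μ =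
      1 / (Fintype.card n * (Fintype.card n + 1)) := by
  set a := ∫ U : Matrix.unitaryGroup n ℂ, Complex.normSq (((U : Matrix n n ℂ) *ᵥ v) i) ^ 2 ∂μ
    with ha
  have hsq : ∀ k, ∫ U : Matrix.unitaryGroup n ℂ,
      Complex.normSq (((U : Matrix n n ℂ) *ᵥ v) k) ^ 2 ∂μ = a := fun k => by
    rw [ha, ← integral_normSq_dotProduct_sq μ v (Pi.single k 1) (by simp) i]
    simp
  have hmul : ∀ k l, ∫ U : Matrix.unitaryGroup n ℂ,
      Complex.normSq (((U : Matrix n n ℂ) *ᵥ v) k) *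
        Complex.normSq (((U : Matrix n n ℂ) *ᵥ v) l) ∂μ = a / 2 + if k = l then a / 2 else 0 := by
    intro k l
    split_ifs with h
    · subst h
      rw [← hsq k]
      simp only [← sq]
      ring
    · have := integral_normSq_mulVec_sq_eq_two_mul μ v h
      rw [hsq k] at this
      linarith
  have htot : ∫ U : Matrix.unitaryGroup n ℂ,
      ∑ k, ∑ l, Complex.normSq (((U : Matrix n n ℂ) *ᵥ v) k) *
        Complex.normSq (((U : Matrix n n ℂ) *ᵥ v) l) ∂μ = 1 := by
    simp [← Finset.sum_mul_sum, sum_normSq_unitary_mulVec, hv]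
  rw [integral_finsetSum _ fun k _ => integrable_finsetSum _ fun l _ =>
    integrable_normSq_mulVec_mul_normSq_mulVec μ v k l] at htot
  simp_rw [integral_finsetSum _ fun l _ =>
    integrable_normSq_mulVec_mul_normSq_mulVec μ v _ l, hmul] at htot
  simp [Finset.sum_add_distrib] at htot
  have hpos : (0 : ℝ) < Fintype.card n := by
    exact_mod_cast Fintype.card_pos_iff.mpr ⟨i⟩
  rw [hmul, if_neg hij]
  field_simp
  linarith

end HaarMoments

theorem globalGrad_conj_mul (N : ℕ) (A : Matrix (Fin N) (Fin N) ℂ) (v : Fin N → ℂ)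
    (W U : Matrix.unitaryGroup (Fin N) ℂ) :
    globalGrad N (W * A * (W : Matrix (Fin N) (Fin N) ℂ)ᴴ) v (W * U) =
      W * globalGrad N A v U := by
  have hW : (W : Matrix (Fin N) (Fin N) ℂ)ᴴ * W = 1 := by
    rw [← star_eq_conjTranspose, Unitary.coe_star_mul_self]
  have hW' : ∀ X : Matrix (Fin N) (Fin N) ℂ, (W : Matrix (Fin N) (Fin N) ℂ)ᴴ * (W * X) = X :=
    fun X => by rw [← Matrix.mul_assoc, hW, Matrix.one_mul]
  simp only [globalGrad, Submonoid.coe_mul, conjTranspose_mul, Matrix.mul_assoc, hW',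
    Matrix.mul_sub]

theorem trace_globalGrad_unitary_mul (N : ℕ) (A : Matrix (Fin N) (Fin N) ℂ) (v : Fin N → ℂ)
    (W U : Matrix.unitaryGroup (Fin N) ℂ) :
    ((globalGrad N (W * A * (W : Matrix (Fin N) (Fin N) ℂ)ᴴ) v (W * U))ᴴ *
      globalGrad N (W * A * (W : Matrix (Fin N) (Fin N) ℂ)ᴴ) v (W * U)).trace =
      ((globalGrad N A v U)ᴴ * globalGrad N A v U).trace := by
  have hW : (W : Matrix (Fin N) (Fin N) ℂ)ᴴ * W = 1 := by
    rw [← star_eq_conjTranspose, Unitary.coe_star_mul_self]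
  rw [globalGrad_conj_mul, conjTranspose_mul, Matrix.mul_assoc,
    ← Matrix.mul_assoc (W : Matrix (Fin N) (Fin N) ℂ)ᴴ, hW, Matrix.one_mul]

theorem trace_globalGrad_diagonal (N : ℕ) (l : Fin N → ℝ) (v : Fin N → ℂ)
    (U : Matrix.unitaryGroup (Fin N) ℂ) :
    ((globalGrad N (diagonal fun i => (l i : ℂ)) v U)ᴴ *
      globalGrad N (diagonal fun i => (l i : ℂ)) v U).trace =
      ((∑ i, ∑ j, (l i - l j) ^ 2 *
        (Complex.normSq (((U : Matrix (Fin N) (Fin N) ℂ) *ᵥ v) i) *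
          Complex.normSq (((U : Matrix (Fin N) (Fin N) ℂ) *ᵥ v) j)) : ℝ) : ℂ) := by
  set ψ := (U : Matrix (Fin N) (Fin N) ℂ) *ᵥ v with hψ
  have hU : (U : Matrix (Fin N) (Fin N) ℂ)ᴴ * U = 1 := by
    rw [← star_eq_conjTranspose, Unitary.coe_star_mul_self]
  have hU' : (U : Matrix (Fin N) (Fin N) ℂ) * (U : Matrix (Fin N) (Fin N) ℂ)ᴴ = 1 :=
    mul_eq_one_comm.mp hU
  have hρ : (U : Matrix (Fin N) (Fin N) ℂ) * vecMulVec v (star v) *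
      (U : Matrix (Fin N) (Fin N) ℂ)ᴴ = vecMulVec ψ (star ψ) := by
    rw [mul_vecMulVec, vecMulVec_mul, hψ, star_mulVec]
  have hρ' : (U : Matrix (Fin N) (Fin N) ℂ) * vecMulVec v (star v) =
      vecMulVec ψ (star ψ) * U := by
    rw [← hρ, Matrix.mul_assoc, hU, Matrix.mul_one]
  set C : Matrix (Fin N) (Fin N) ℂ := of fun i j => ((l i : ℂ) - l j) * (ψ i * star (ψ j))
    with hC
  have hg : globalGrad N (diagonal fun i => (l i : ℂ)) v U = C * U := by
    have : C = diagonal (fun i => (l i : ℂ)) * vecMulVec ψ (star ψ) -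
        vecMulVec ψ (star ψ) * diagonal (fun i => (l i : ℂ)) := by
      ext i j
      simp [hC, vecMulVec_apply]
      ring
    rw [globalGrad, hρ, Matrix.mul_assoc (diagonal _), hρ', this, Matrix.sub_mul,
      Matrix.mul_assoc (diagonal _)]
  rw [hg, conjTranspose_mul, Matrix.mul_assoc, trace_mul_comm, Matrix.mul_assoc,
    Matrix.mul_assoc, hU', Matrix.mul_one, trace_mul_comm]
  simp only [trace, diag, Matrix.mul_apply, conjTranspose_apply, hC, of_apply]
  push_cast
  refine Finset.sum_congr rfl fun i _ => Finset.sum_congr rfl fun j _ => ?_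
  simp [Complex.normSq_eq_conj_mul_self]
  ring

theorem integral_globalGrad_apply (N : ℕ) (μ : Measure (Matrix.unitaryGroup (Fin N) ℂ))
    [μ.IsHaarMeasure] (H : Matrix (Fin N) (Fin N) ℂ) (v : Fin N → ℂ) (i j : Fin N) :
    ∫ U, globalGrad N H v U i j ∂μ = 0 := by
  have h := integral_mul_left_eq_self (μ := μ) (fun U => globalGrad N H v U i j) (-1)
  have hneg : ∀ U : Matrix.unitaryGroup (Fin N) ℂ,
      globalGrad N H v (-1 * U) i j = -globalGrad N H v U i j := fun U => by
    rw [neg_one_mul]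
    have hcoe : ((-U : Matrix.unitaryGroup (Fin N) ℂ) : Matrix (Fin N) (Fin N) ℂ) = -U := rfl
    rw [globalGrad, hcoe]
    simp [globalGrad]
    ring
  simp_rw [hneg, integral_neg] at h
  exact self_eq_neg.mp h.symm

theorem integral_trace_globalGrad (N : ℕ) (μ : Measure (Matrix.unitaryGroup (Fin N) ℂ))
    [μ.IsHaarMeasure] [IsProbabilityMeasure μ] (H : Matrix (Fin N) (Fin N) ℂ)
    (hH : H.IsHermitian) (hH0 : H.trace = 0) (v : Fin N → ℂ)
    (hv : ∑ s, Complex.normSq (v s) = 1) :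
    ∫ U, ((globalGrad N H v U)ᴴ * globalGrad N H v U).trace ∂μ =
      2 * N * (H * H).trace * (1 / ((N : ℂ) * (N + 1))) := by
  set W := hH.eigenvectorUnitary
  set l := hH.eigenvalues
  have hW : (W : Matrix (Fin N) (Fin N) ℂ)ᴴ * W = 1 := by
    rw [← star_eq_conjTranspose, Unitary.coe_star_mul_self]
  have hspec : H = W * diagonal (fun i => (l i : ℂ)) * (W : Matrix (Fin N) (Fin N) ℂ)ᴴ := by
    conv_lhs => rw [hH.spectral_theorem]
    rfl
  have hl : ∑ i, l i = 0 := by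
    have := hH.trace_eq_sum_eigenvalues
    rw [hH0] at this
    exact Complex.ofReal_injective (by simpa using this.symm)
  have hl2 : (H * H).trace = ((∑ i, l i ^ 2 : ℝ) : ℂ) := by
    have hHH : H * H = W * diagonal (fun i => (l i : ℂ)) *
        ((W : Matrix (Fin N) (Fin N) ℂ)ᴴ * W) *
          (diagonal (fun i => (l i : ℂ)) * (W : Matrix (Fin N) (Fin N) ℂ)ᴴ) := by
      conv_lhs => rw [hspec]
      simp only [Matrix.mul_assoc]
    rw [hHH, hW, Matrix.mul_one, Matrix.mul_assoc, trace_mul_comm, Matrix.mul_assoc,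
      Matrix.mul_assoc, hW]
    simp [sq]
  have hint : ∀ i j, Integrable (fun U : Matrix.unitaryGroup (Fin N) ℂ => (l i - l j) ^ 2 *
      (Complex.normSq (((U : Matrix (Fin N) (Fin N) ℂ) *ᵥ v) i) *
        Complex.normSq (((U : Matrix (Fin N) (Fin N) ℂ) *ᵥ v) j))) μ := fun i j =>
    (integrable_normSq_mulVec_mul_normSq_mulVec μ v i j).const_mul _
  have hterm : ∀ i j, ∫ U : Matrix.unitaryGroup (Fin N) ℂ, (l i - l j) ^ 2 *
      (Complex.normSq (((U : Matrix (Fin N) (Fin N) ℂ) *ᵥ v) i) *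
        Complex.normSq (((U : Matrix (Fin N) (Fin N) ℂ) *ᵥ v) j)) ∂μ =
      (l i - l j) ^ 2 * (1 / ((N : ℝ) * (N + 1))) := fun i j => by
    rcases eq_or_ne i j with rfl | hij
    · simp
    · rw [integral_const_mul, integral_normSq_mulVec_mul_normSq_mulVec μ v hv hij,
        Fintype.card_fin]
  have hsum : ∑ i, ∑ j, (l i - l j) ^ 2 = 2 * N * ∑ i, l i ^ 2 := by
    simp only [sub_sq, Finset.sum_add_distrib, Finset.sum_sub_distrib, ← Finset.mul_sum, hl]
    simp [← Finset.mul_sum]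
    ring
  rw [← integral_mul_left_eq_self _ W, hl2]
  conv_lhs => rw [hspec]
  simp_rw [trace_globalGrad_unitary_mul, trace_globalGrad_diagonal]
  rw [integral_complex_ofReal,
    integral_finsetSum _ fun i _ => integrable_finsetSum _ fun j _ => hint i j]
  simp_rw [integral_finsetSum _ fun j _ => hint _ j, hterm, ← Finset.sum_mul]
  rw [hsum]
  push_cast
  ring

/-- Theorem 1 (barren plateau for a global unitary): for a system of `L` sites of local
dimension `d ≥ 2` with Hilbert space `ℂ^N`, `N = d^L`, a traceless Hermitian Hamiltonian `H`,
and a Haar-random global unitary, the Riemannian energy gradient has zero mean and variance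
`2 Tr(H²)/(d^L (d^L + 1))`, which decays exponentially in `L`. -/
theorem barren_plateau_global_unitary (d L : ℕ) (hd : 2 ≤ d) (hL : 1 ≤ L)
    (N : ℕ) (hN : N = d ^ L)
    (μ : Measure (Matrix.unitaryGroup (Fin N) ℂ))
    [μ.IsHaarMeasure] [IsProbabilityMeasure μ]
    (H : Matrix (Fin N) (Fin N) ℂ) (hH : H.IsHermitian) (hH0 : H.trace = 0)
    (v : Fin N → ℂ) (hv : ∑ s, ‖v s‖ ^ 2 = 1) :
    (∀ i j : Fin N, ∫ U, globalGrad N H v U i j ∂μ = 0)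
      ∧ (1 / (N : ℂ)) * ∫ U, ((globalGrad N H v U)ᴴ * globalGrad N H v U).trace ∂μ
          = 2 * (H * H).trace * (1 / (((d : ℂ) ^ L) * ((d : ℂ) ^ L + 1))) := by
  have hv' : ∑ s, Complex.normSq (v s) = 1 := by
    simpa only [Complex.normSq_eq_norm_sq] using hv
  have hN0 : (N : ℂ) ≠ 0 := by
    rw [hN]
    exact_mod_cast pow_ne_zero L (by omega : d ≠ 0)
  have hNd : (d : ℂ) ^ L = N := by rw [hN, Nat.cast_pow]
  refine ⟨integral_globalGrad_apply N μ H v, ?_⟩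
  rw [integral_trace_globalGrad N μ H hH hH0 v hv', hNd]
  field_simp
end
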